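/- arXiv:1610.09208 — 6 statements merged into one kernel-verified Lean document; each statement's English description precedes it below -/
import Mathlib

section
/- Every binary quartic form F with complex coefficients and non-zero discriminant is GL₂(ℂ)-equivalent to a form x⁴ + A x²y² + y⁴ for some complex number A; that is, there exist T ∈ GL₂(ℂ) and A ∈ ℂ such that F_T(x,y) = x⁴ + A x²y² + y⁴. -/
/-- The binary quartic form `F(x,y) = a₄x⁴ + a₃x³y + a₂x²y² + a₁xy³ + a₀y⁴`. -/
noncomputable def quarticForm (a₄ a₃ a₂ a₁ a₀ x y : ℂ) : ℂ :=
  a₄ * x ^ 4 + a₃ * x ^ 3 * y + a₂ * x ^ 2 * y ^ 2 + a₁ * x * y ^ 3 + a₀ * y ^ 4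

/-- The invariant `I(F)` of a binary quartic form. -/
noncomputable def quarticI (a₄ a₃ a₂ a₁ a₀ : ℂ) : ℂ :=
  12 * a₄ * a₀ - 3 * a₃ * a₁ + a₂ ^ 2

/-- The invariant `J(F)` of a binary quartic form. -/
noncomputable def quarticJ (a₄ a₃ a₂ a₁ a₀ : ℂ) : ℂ :=
  72 * a₄ * a₂ * a₀ + 9 * a₃ * a₂ * a₁ - 27 * a₄ * a₁ ^ 2 - 27 * a₀ * a₃ ^ 2 - 2 * a₂ ^ 3

/-- The discriminant of a binary quartic form: `Δ(F) = (4I(F)³ - J(F)²)/27`. -/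
noncomputable def quarticDisc (a₄ a₃ a₂ a₁ a₀ : ℂ) : ℂ :=
  (4 * quarticI a₄ a₃ a₂ a₁ a₀ ^ 3 - quarticJ a₄ a₃ a₂ a₁ a₀ ^ 2) / 27

open Polynomial in
lemma exists_cubic_eq_zero {a b c d : ℂ} (ha : a ≠ 0) :
    ∃ z : ℂ, a * z ^ 3 + b * z ^ 2 + c * z + d = 0 := by
  obtain ⟨z, hz⟩ := IsAlgClosed.exists_root (C a * X ^ 3 + C b * X ^ 2 + C c * X + C d)
    (by rw [degree_cubic ha]; norm_num)
  exact ⟨z, by simpa using hz⟩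

open Polynomial in
lemma exists_quartic_eq_zero {a b c d e : ℂ} (ha : a ≠ 0) :
    ∃ z : ℂ, a * z ^ 4 + b * z ^ 3 + c * z ^ 2 + d * z + e = 0 := by
  have hdeg : (C a * X ^ 4 + C b * X ^ 3 + C c * X ^ 2 + C d * X + C e).degree = 4 := by
    compute_degree!
  obtain ⟨z, hz⟩ := IsAlgClosed.exists_root _ (by rw [hdeg]; norm_num)
  exact ⟨z, by simpa using hz⟩

/-- A function of two variables becomes `x⁴ + Ax²y² + y⁴` after an invertible linear
substitution. -/
def HasQuarticNormalForm (f : ℂ → ℂ → ℂ) : Prop :=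
  ∃ p q r s A : ℂ, p * s - q * r ≠ 0 ∧
    ∀ x y, f (p * x + q * y) (r * x + s * y) = x ^ 4 + A * x ^ 2 * y ^ 2 + y ^ 4

lemma HasQuarticNormalForm.of_subst {f g : ℂ → ℂ → ℂ} (hg : HasQuarticNormalForm g)
    (p q r s : ℂ) (hdet : p * s - q * r ≠ 0)
    (hfg : ∀ x y, g x y = f (p * x + q * y) (r * x + s * y)) : HasQuarticNormalForm f := by
  obtain ⟨p', q', r', s', A, hdet', h⟩ := hg
  refine ⟨p * p' + q * r', p * q' + q * s', r * p' + s * r', r * q' + s * s', A, ?_, ?_⟩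
  · convert mul_ne_zero hdet hdet' using 1
    ring
  · intro x y
    rw [← h, hfg]
    congr 1 <;> ring

/-- The case of a form vanishing at both `(1, 0)` and `(0, 1)`. -/
lemma hasQuarticNormalForm_of_two_roots {a₃ a₂ a₁ : ℂ} (hΔ : quarticDisc 0 a₃ a₂ a₁ 0 ≠ 0) :
    HasQuarticNormalForm (quarticForm 0 a₃ a₂ a₁ 0) := by
  have hdisc : quarticDisc 0 a₃ a₂ a₁ 0 = a₃ ^ 2 * a₁ ^ 2 * (a₂ ^ 2 - 4 * a₃ * a₁) := by
    simp only [quarticDisc, quarticI, quarticJ]; ring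
  rw [hdisc] at hΔ
  obtain ⟨p, rfl⟩ := IsAlgClosed.exists_pow_nat_eq a₁ (n := 2) (by norm_num)
  obtain ⟨q, rfl⟩ := IsAlgClosed.exists_pow_nat_eq a₃ (n := 2) (by norm_num)
  have hp : p ≠ 0 := by rintro rfl; simp at hΔ
  have hq : q ≠ 0 := by rintro rfl; simp at hΔ
  have hα : p ^ 2 * q ^ 2 * (a₂ + 2 * p * q) ≠ 0 := fun h ↦ hΔ (by
    linear_combination (q ^ 2 * p ^ 2 * (a₂ - 2 * p * q)) * h)
  have hγ : p ^ 2 * q ^ 2 * (a₂ - 2 * p * q) ≠ 0 := fun h ↦ hΔ (by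
    linear_combination (q ^ 2 * p ^ 2 * (a₂ + 2 * p * q)) * h)
  obtain ⟨s, hs⟩ := IsAlgClosed.exists_pow_nat_eq (p ^ 2 * q ^ 2 * (a₂ + 2 * p * q))⁻¹
    (n := 4) (by norm_num)
  obtain ⟨t, ht⟩ := IsAlgClosed.exists_pow_nat_eq (p ^ 2 * q ^ 2 * (a₂ - 2 * p * q))⁻¹
    (n := 4) (by norm_num)
  have hs0 : s ≠ 0 := by rintro rfl; exact inv_ne_zero hα (by simpa using hs.symm)
  have ht0 : t ≠ 0 := by rintro rfl; exact inv_ne_zero hγ (by simpa using ht.symm)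
  have hs1 := mul_inv_cancel₀ hα
  have ht1 := mul_inv_cancel₀ hγ
  rw [← hs] at hs1
  rw [← ht] at ht1
  refine ⟨p * s, p * t, q * s, -(q * t), -2 * p ^ 2 * q ^ 2 * a₂ * s ^ 2 * t ^ 2, ?_, ?_⟩
  · have : (-2 : ℂ) * p * q * s * t ≠ 0 := by simp [*]
    convert this using 1
    ring
  · intro x y
    simp only [quarticForm]
    linear_combination x ^ 4 * hs1 + y ^ 4 * ht1

/-- The case of a form vanishing at `(1, 0)`. -/
lemma hasQuarticNormalForm_of_root {a₃ a₂ a₁ a₀ : ℂ} (hΔ : quarticDisc 0 a₃ a₂ a₁ a₀ ≠ 0) :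
    HasQuarticNormalForm (quarticForm 0 a₃ a₂ a₁ a₀) := by
  have ha : a₃ ≠ 0 := by
    rintro rfl
    apply hΔ
    simp only [quarticDisc, quarticI, quarticJ]
    ring
  obtain ⟨e, he⟩ := exists_cubic_eq_zero (b := a₂) (c := a₁) (d := a₀) ha
  obtain rfl : a₀ = -(a₃ * e ^ 3 + a₂ * e ^ 2 + a₁ * e) := by linear_combination he
  refine (hasQuarticNormalForm_of_two_roots (a₃ := a₃) (a₂ := 3 * a₃ * e + a₂)
    (a₁ := 3 * a₃ * e ^ 2 + 2 * a₂ * e + a₁) ?_).of_subst 1 e 0 1 (by simp) ?_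
  · convert hΔ using 1
    simp only [quarticDisc, quarticI, quarticJ]
    ring
  · intro x y
    simp only [quarticForm]
    ring

lemma hasQuarticNormalForm_of_disc_ne_zero {a₄ a₃ a₂ a₁ a₀ : ℂ}
    (hΔ : quarticDisc a₄ a₃ a₂ a₁ a₀ ≠ 0) :
    HasQuarticNormalForm (quarticForm a₄ a₃ a₂ a₁ a₀) := by
  by_cases ha : a₄ = 0
  · subst ha
    exact hasQuarticNormalForm_of_root hΔ
  obtain ⟨e, he⟩ := exists_quartic_eq_zero (b := a₃) (c := a₂) (d := a₁) (e := a₀) ha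
  obtain rfl : a₀ = -(a₄ * e ^ 4 + a₃ * e ^ 3 + a₂ * e ^ 2 + a₁ * e) := by
    linear_combination he
  refine (hasQuarticNormalForm_of_root (a₃ := 4 * a₄ * e ^ 3 + 3 * a₃ * e ^ 2 + 2 * a₂ * e + a₁)
    (a₂ := 6 * a₄ * e ^ 2 + 3 * a₃ * e + a₂) (a₁ := 4 * a₄ * e + a₃)
    (a₀ := a₄) ?_).of_subst e 1 1 0 (by simp) ?_
  · convert hΔ using 1
    simp only [quarticDisc, quarticI, quarticJ]
    ring
  · intro x y
    simp only [quarticForm]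
    ring

/-- Every binary quartic form with complex coefficients and non-zero discriminant is
`GL₂(ℂ)`-equivalent to `x⁴ + Ax²y² + y⁴` for some complex number `A`. -/
theorem quartic_equiv_normal_form (a₄ a₃ a₂ a₁ a₀ : ℂ)
    (hΔ : quarticDisc a₄ a₃ a₂ a₁ a₀ ≠ 0) :
    ∃ (T : Matrix (Fin 2) (Fin 2) ℂ) (A : ℂ), T.det ≠ 0 ∧
      ∀ x y : ℂ,
        quarticForm a₄ a₃ a₂ a₁ a₀ (T 0 0 * x + T 0 1 * y) (T 1 0 * x + T 1 1 * y)
          = x ^ 4 + A * x ^ 2 * y ^ 2 + y ^ 4 := by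
  obtain ⟨p, q, r, s, A, hdet, h⟩ := hasQuarticNormalForm_of_disc_ne_zero hΔ
  exact ⟨!![p, q; r, s], A, by simpa [Matrix.det_fin_two] using hdet, by simpa using h⟩
end

section
/- Let F be a binary quartic form with complex coefficients and non-zero discriminant. If I(F) = 0, then F is GL₂(ℂ)-equivalent to x(x³ + y³); if J(F) = 0, then F is GL₂(ℂ)-equivalent to x⁴ + y⁴. -/
/-- `g` arises from `f` by an invertible linear substitution of the variables. -/
def LinearSubstEquiv (f g : ℂ → ℂ → ℂ) : Prop :=
  ∃ T : Matrix (Fin 2) (Fin 2) ℂ, T.det ≠ 0 ∧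
    ∀ x y : ℂ, f (T 0 0 * x + T 0 1 * y) (T 1 0 * x + T 1 1 * y) = g x y

namespace LinearSubstEquiv

theorem trans {f g h : ℂ → ℂ → ℂ} (hfg : LinearSubstEquiv f g) (hgh : LinearSubstEquiv g h) :
    LinearSubstEquiv f h := by
  obtain ⟨S, hS, hfg⟩ := hfg
  obtain ⟨T, hT, hgh⟩ := hgh
  refine ⟨S * T, by simpa [Matrix.det_mul] using ⟨hS, hT⟩, fun x y => ?_⟩
  rw [← hgh, ← hfg]
  simp only [Matrix.mul_apply, Fin.sum_univ_two]
  congr 1 <;> ring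

theorem of_coeffs {f g : ℂ → ℂ → ℂ} (a b c d : ℂ) (hdet : a * d - b * c ≠ 0)
    (h : ∀ x y, f (a * x + b * y) (c * x + d * y) = g x y) : LinearSubstEquiv f g :=
  ⟨!![a, b; c, d], by simpa [Matrix.det_fin_two] using hdet, by simpa using h⟩

end LinearSubstEquiv

theorem exists_root_of_leadingCoeff_ne_zero {a₄ : ℂ} (a₃ a₂ a₁ a₀ : ℂ) (h : a₄ ≠ 0) :
    ∃ r : ℂ, quarticForm a₄ a₃ a₂ a₁ a₀ r 1 = 0 := by
  open Polynomial in
  have hdeg : (C a₄ * X ^ 4 + C a₃ * X ^ 3 + C a₂ * X ^ 2 + C a₁ * X + C a₀ : ℂ[X]).degree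
      = 4 := by
    compute_degree!
  obtain ⟨r, hr⟩ := IsAlgClosed.exists_root _ (by rw [hdeg]; norm_num)
  refine ⟨r, ?_⟩
  simpa [quarticForm, Polynomial.IsRoot] using hr

/-- Every binary quartic form is equivalent, with the same `I` and `J`, to one divisible by `y`. -/
theorem exists_linearSubstEquiv_leadingCoeff_zero (a₄ a₃ a₂ a₁ a₀ : ℂ) :
    ∃ b₃ b₂ b₁ b₀ : ℂ,
      LinearSubstEquiv (quarticForm a₄ a₃ a₂ a₁ a₀) (quarticForm 0 b₃ b₂ b₁ b₀) ∧
      quarticI 0 b₃ b₂ b₁ b₀ = quarticI a₄ a₃ a₂ a₁ a₀ ∧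
      quarticJ 0 b₃ b₂ b₁ b₀ = quarticJ a₄ a₃ a₂ a₁ a₀ := by
  by_cases h : a₄ = 0
  · subst h
    exact ⟨a₃, a₂, a₁, a₀, .of_coeffs 1 0 0 1 (by simp) (by simp), rfl, rfl⟩
  obtain ⟨r, hr⟩ := exists_root_of_leadingCoeff_ne_zero a₃ a₂ a₁ a₀ h
  have ha₀ : a₀ = -(a₄ * r ^ 4 + a₃ * r ^ 3 + a₂ * r ^ 2 + a₁ * r) := by
    simp only [quarticForm] at hr
    linear_combination hr
  refine ⟨4 * a₄ * r ^ 3 + 3 * a₃ * r ^ 2 + 2 * a₂ * r + a₁,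
    6 * a₄ * r ^ 2 + 3 * a₃ * r + a₂, 4 * a₄ * r + a₃, a₄,
    .of_coeffs r 1 1 0 (by simp) fun x y => ?_, ?_, ?_⟩ <;>
  · simp only [quarticForm, quarticI, quarticJ, ha₀]
    ring

/-- A binary quartic form with non-zero discriminant is equivalent, with the same `I` and `J`,
to `b x³y + p xy³ + q y⁴` with `b ≠ 0`. -/
theorem exists_linearSubstEquiv_depressed {a₄ a₃ a₂ a₁ a₀ : ℂ}
    (hΔ : quarticDisc a₄ a₃ a₂ a₁ a₀ ≠ 0) :
    ∃ b p q : ℂ, b ≠ 0 ∧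
      LinearSubstEquiv (quarticForm a₄ a₃ a₂ a₁ a₀) (quarticForm 0 b 0 p q) ∧
      quarticI 0 b 0 p q = quarticI a₄ a₃ a₂ a₁ a₀ ∧
      quarticJ 0 b 0 p q = quarticJ a₄ a₃ a₂ a₁ a₀ := by
  obtain ⟨b₃, b₂, b₁, b₀, hequiv, hI, hJ⟩ :=
    exists_linearSubstEquiv_leadingCoeff_zero a₄ a₃ a₂ a₁ a₀
  have hb : b₃ ≠ 0 := by
    rintro rfl
    apply hΔ
    rw [quarticDisc, ← hI, ← hJ, quarticI, quarticJ]
    ring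
  obtain ⟨t, rfl⟩ : ∃ t, b₂ = 3 * b₃ * t := ⟨b₂ / (3 * b₃), by field_simp⟩
  refine ⟨b₃, b₁ - 3 * b₃ * t ^ 2, b₀ - b₁ * t + 2 * b₃ * t ^ 3, hb,
    hequiv.trans (.of_coeffs 1 (-t) 0 1 (by simp) fun x y => ?_), hI ▸ ?_, hJ ▸ ?_⟩ <;>
  · simp only [quarticForm, quarticI, quarticJ]
    ring

theorem linearSubstEquiv_of_linear_coeff_zero {b q : ℂ} (hb : b ≠ 0) (hq : q ≠ 0) :
    LinearSubstEquiv (quarticForm 0 b 0 0 q) fun x y => x * (x ^ 3 + y ^ 3) := by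
  obtain ⟨l, hl⟩ := IsAlgClosed.exists_pow_nat_eq q⁻¹ (n := 4) (by norm_num)
  have hl₀ : l ≠ 0 := by
    rintro rfl
    exact inv_ne_zero hq (by simpa using hl.symm)
  obtain ⟨m, hm⟩ := IsAlgClosed.exists_pow_nat_eq (b * l)⁻¹ (n := 3) (by norm_num)
  have hm₀ : m ≠ 0 := by
    rintro rfl
    exact inv_ne_zero (mul_ne_zero hb hl₀) (by simpa using hm.symm)
  have hql : q * l ^ 4 = 1 := by rw [hl, mul_inv_cancel₀ hq]
  have hbm : b * l * m ^ 3 = 1 := by rw [hm, mul_inv_cancel₀ (mul_ne_zero hb hl₀)]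
  refine .of_coeffs 0 m l 0 (by simp [hl₀, hm₀]) fun x y => ?_
  simp only [quarticForm]
  linear_combination x ^ 4 * hql + x * y ^ 3 * hbm

theorem linearSubstEquiv_of_constant_coeff_zero {b p : ℂ} (hb : b ≠ 0) (hp : p ≠ 0) :
    LinearSubstEquiv (quarticForm 0 b 0 p 0) fun x y => x ^ 4 + y ^ 4 := by
  obtain ⟨u, rfl⟩ := IsAlgClosed.exists_pow_nat_eq p (n := 2) (by norm_num)
  obtain ⟨v, rfl⟩ := IsAlgClosed.exists_pow_nat_eq b (n := 2) (by norm_num)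
  have hu : u ≠ 0 := by simpa using hp
  have hv : v ≠ 0 := by simpa using hb
  have huv : 2 * u ^ 3 * v ^ 3 ≠ 0 := by simp [hu, hv]
  obtain ⟨s, hs⟩ := IsAlgClosed.exists_pow_nat_eq (2 * u ^ 3 * v ^ 3)⁻¹ (n := 4) (by norm_num)
  obtain ⟨w, hw⟩ := IsAlgClosed.exists_pow_nat_eq (-1 : ℂ) (n := 4) (by norm_num)
  have hs₀ : s ≠ 0 := by
    rintro rfl
    exact inv_ne_zero huv (by simpa using hs.symm)
  have hw₀ : w ≠ 0 := by
    rintro rfl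
    norm_num at hw
  have huvs : 2 * u ^ 3 * v ^ 3 * s ^ 4 = 1 := by rw [hs, mul_inv_cancel₀ huv]
  have hdet : u * s * -(v * s * w) - u * s * w * (v * s) ≠ 0 := by
    have : u * s * -(v * s * w) - u * s * w * (v * s) = -2 * (u * v * w * s ^ 2) := by ring
    rw [this]
    simp [hu, hv, hw₀, hs₀]
  refine .of_coeffs (u * s) (u * s * w) (v * s) (-(v * s * w)) hdet fun x y => ?_
  simp only [quarticForm]
  linear_combination (x ^ 4 - w ^ 4 * y ^ 4) * huvs - y ^ 4 * hw

/-- A binary quartic form with non-zero discriminant and `I(F) = 0` is `GL₂(ℂ)`-equivalent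
to `x(x³ + y³)`, and one with `J(F) = 0` is `GL₂(ℂ)`-equivalent to `x⁴ + y⁴`. -/
theorem quartic_equiv_of_invariant_zero (a₄ a₃ a₂ a₁ a₀ : ℂ)
    (hΔ : quarticDisc a₄ a₃ a₂ a₁ a₀ ≠ 0) :
    (quarticI a₄ a₃ a₂ a₁ a₀ = 0 →
      ∃ T : Matrix (Fin 2) (Fin 2) ℂ, T.det ≠ 0 ∧
        ∀ x y : ℂ,
          quarticForm a₄ a₃ a₂ a₁ a₀ (T 0 0 * x + T 0 1 * y) (T 1 0 * x + T 1 1 * y)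
            = x * (x ^ 3 + y ^ 3)) ∧
    (quarticJ a₄ a₃ a₂ a₁ a₀ = 0 →
      ∃ T : Matrix (Fin 2) (Fin 2) ℂ, T.det ≠ 0 ∧
        ∀ x y : ℂ,
          quarticForm a₄ a₃ a₂ a₁ a₀ (T 0 0 * x + T 0 1 * y) (T 1 0 * x + T 1 1 * y)
            = x ^ 4 + y ^ 4) := by
  obtain ⟨b, p, q, hb, hequiv, hI, hJ⟩ := exists_linearSubstEquiv_depressed hΔ
  rw [quarticDisc, ← hI, ← hJ] at hΔ
  rw [← hI, ← hJ]
  constructor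
  · intro h
    obtain rfl : p = 0 := by simpa [quarticI, hb] using h
    have hq : q ≠ 0 := by
      rintro rfl
      simp [quarticI, quarticJ] at hΔ
    exact hequiv.trans (linearSubstEquiv_of_linear_coeff_zero hb hq)
  · intro h
    obtain rfl : q = 0 := by simpa [quarticJ, hb] using h
    have hp : p ≠ 0 := by
      rintro rfl
      simp [quarticI, quarticJ] at hΔ
    exact hequiv.trans (linearSubstEquiv_of_constant_coeff_zero hb hp)
end

section
/- Let F be a binary cubic form with complex coefficients, non-zero discriminant, and non-zero x³-coefficient, and let θ₁, θ₂, θ₃ be the three distinct roots of F(x,1). Then the six matrices I (the 2×2 identity), 𝒯_{θ₁}, 𝒯_{θ₂}, 𝒯_{θ₃}, 𝒩_{q_F}, 𝒩_{q_F}² form a complete set of representatives in GL₂(ℂ) of the group Aut*_ℂ F ⊂ PGL₂(ℂ). -/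
/-- The principal square root of a complex number: non-negative real part, and positive
imaginary part when the real part vanishes. -/
noncomputable def csqrt (z : ℂ) : ℂ := z ^ ((1 : ℂ) / 2)

/-- The binary cubic form `F(x,y) = b₃x³ + b₂x²y + b₁xy² + b₀y³`. -/
noncomputable def cubicForm (b₃ b₂ b₁ b₀ x y : ℂ) : ℂ :=
  b₃ * x ^ 3 + b₂ * x ^ 2 * y + b₁ * x * y ^ 2 + b₀ * y ^ 3

/-- The discriminant of the binary cubic form with coefficients `b₃, b₂, b₁, b₀`. -/
noncomputable def cubicDisc (b₃ b₂ b₁ b₀ : ℂ) : ℂ :=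
  18 * b₃ * b₂ * b₁ * b₀ - 4 * b₂ ^ 3 * b₀ + b₂ ^ 2 * b₁ ^ 2
    - 4 * b₃ * b₁ ^ 3 - 27 * b₃ ^ 2 * b₀ ^ 2

/-- The matrix `M_f = [[b, 2c], [−2a, −b]]` attached to a binary quadratic form
`f = ax² + bxy + cy²`. -/
noncomputable def Mmat (a b c : ℂ) : Matrix (Fin 2) (Fin 2) ℂ :=
  !![b, 2 * c; -2 * a, -b]

/-- The matrix `N_f` attached to the binary quadratic form `f = ax² + bxy + cy²`. -/
noncomputable def Nmat (a b c : ℂ) : Matrix (Fin 2) (Fin 2) ℂ :=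
  (2 * (b ^ 2 - 4 * a * c))⁻¹ •
    !![b * csqrt (-3 * (b ^ 2 - 4 * a * c)) - (b ^ 2 - 4 * a * c),
        2 * c * csqrt (-3 * (b ^ 2 - 4 * a * c));
      -2 * a * csqrt (-3 * (b ^ 2 - 4 * a * c)),
        -(b * csqrt (-3 * (b ^ 2 - 4 * a * c))) - (b ^ 2 - 4 * a * c)]

/-- The matrix `𝒩_{q_F}` attached to the Hessian covariant
`q_F = (b₂² − 3b₃b₁)x² + (b₂b₁ − 9b₃b₀)xy + (b₁² − 3b₂b₀)y²` of the cubic form `F`. -/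
noncomputable def NqF (b₃ b₂ b₁ b₀ : ℂ) : Matrix (Fin 2) (Fin 2) ℂ :=
  Nmat (b₂ ^ 2 - 3 * b₃ * b₁) (b₂ * b₁ - 9 * b₃ * b₀) (b₁ ^ 2 - 3 * b₂ * b₀)

/-- The matrix `𝒯_θ = (−1/(6Δ(F))) · M_{J_θ} · M_{q_F}`, where `J_θ` is the Julia covariant
of `F` at the root `θ` and `q_F` is the Hessian covariant of `F`. -/
noncomputable def Tmat (b₃ b₂ b₁ b₀ θ : ℂ) : Matrix (Fin 2) (Fin 2) ℂ :=
  (-(6 * cubicDisc b₃ b₂ b₁ b₀)⁻¹) •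
    (Mmat (9 * b₃ ^ 2 * θ ^ 2 + 6 * b₃ * b₂ * θ + 6 * b₃ * b₁ - b₂ ^ 2)
        (6 * b₃ * b₂ * θ ^ 2 + 6 * (b₂ ^ 2 - b₃ * b₁) * θ + 2 * b₂ * b₁)
        (3 * b₃ * b₁ * θ ^ 2 + 3 * (b₂ * b₁ - 3 * b₃ * b₀) * θ
          + 2 * b₁ ^ 2 - 3 * b₂ * b₀) *
      Mmat (b₂ ^ 2 - 3 * b₃ * b₁) (b₂ * b₁ - 9 * b₃ * b₀) (b₁ ^ 2 - 3 * b₂ * b₀))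

/-- The Möbius transformation with matrix `M` sends the finite point `x` to the finite
point `y`. -/
def MapsPoint (M : Matrix (Fin 2) (Fin 2) ℂ) (x y : ℂ) : Prop :=
  M 0 0 * x + M 0 1 = y * (M 1 0 * x + M 1 1) ∧ M 1 0 * x + M 1 1 ≠ 0

namespace MapsPoint

variable {M N : Matrix (Fin 2) (Fin 2) ℂ} {x y z c : ℂ}

theorem one (x : ℂ) : MapsPoint 1 x x := by simp [MapsPoint]

theorem smul (hc : c ≠ 0) (h : MapsPoint M x y) : MapsPoint (c • M) x y := by
  refine ⟨?_, ?_⟩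
  · simp only [Matrix.smul_apply, smul_eq_mul]
    linear_combination c * h.1
  · simp only [Matrix.smul_apply, smul_eq_mul]
    have := mul_ne_zero hc h.2
    contrapose! this
    linear_combination this

theorem mul (hM : MapsPoint M y z) (hN : MapsPoint N x y) : MapsPoint (M * N) x z := by
  refine ⟨?_, ?_⟩
  · simp only [Matrix.mul_apply, Fin.sum_univ_two]
    linear_combination (M 0 0 - z * M 1 0) * hN.1 + (N 1 0 * x + N 1 1) * hM.1
  · simp only [Matrix.mul_apply, Fin.sum_univ_two]
    have := mul_ne_zero hM.2 hN.2
    contrapose! this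
    linear_combination this - M 1 0 * hN.1

theorem eq_of_eq_smul (hM : MapsPoint M x y) (hN : MapsPoint N x z) (h : M = c • N) : y = z := by
  subst h
  obtain ⟨h₁, h₂⟩ := hM
  simp only [Matrix.smul_apply, smul_eq_mul] at h₁ h₂
  refine mul_right_cancel₀ h₂ ?_
  linear_combination c * hN.1 - h₁

theorem injective {x' : ℂ} (hdet : M.det ≠ 0) (hx : MapsPoint M x y) (hx' : MapsPoint M x' y) :
    x = x' := by
  by_contra hne
  have h₀ : M 0 0 - y * M 1 0 = 0 := by
    refine (mul_eq_zero.mp ?_).resolve_right (sub_ne_zero.mpr hne)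
    linear_combination hx.1 - hx'.1
  apply hdet
  rw [Matrix.det_fin_two]
  linear_combination (M 1 1 + M 1 0 * x) * h₀ - M 1 0 * hx.1

theorem det_ne_zero {x' y' : ℂ} (hx : MapsPoint M x y) (hx' : MapsPoint M x' y') (hne : y ≠ y') :
    M.det ≠ 0 := by
  have := mul_ne_zero (mul_ne_zero hx.2 hx'.2) (sub_ne_zero.mpr hne)
  contrapose! this
  rw [Matrix.det_fin_two] at this
  linear_combination (x - x') * this - (M 1 0 * x' + M 1 1) * hx.1 + (M 1 0 * x + M 1 1) * hx'.1

/-- A linear fractional transformation is determined by its values at three points. -/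
theorem eq_smul_of_three {x y : Fin 3 → ℂ} (hx : Function.Injective x) (hdet : N.det ≠ 0)
    (hM : ∀ i, MapsPoint M (x i) (y i)) (hN : ∀ i, MapsPoint N (x i) (y i)) :
    ∃ c : ℂ, M = c • N := by
  have key (i : Fin 3) : (M 0 0 * N 1 0 - N 0 0 * M 1 0) * x i ^ 2
      + (M 0 0 * N 1 1 + M 0 1 * N 1 0 - N 0 0 * M 1 1 - N 0 1 * M 1 0) * x i
      + (M 0 1 * N 1 1 - N 0 1 * M 1 1) = 0 := by
    linear_combination (N 1 0 * x i + N 1 1) * (hM i).1 - (M 1 0 * x i + M 1 1) * (hN i).1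
  have h01 : x 0 - x 1 ≠ 0 := sub_ne_zero.mpr (hx.ne (by decide))
  have h02 : x 0 - x 2 ≠ 0 := sub_ne_zero.mpr (hx.ne (by decide))
  have h12 : x 1 - x 2 ≠ 0 := sub_ne_zero.mpr (hx.ne (by decide))
  have e₂ : M 0 0 * N 1 0 - N 0 0 * M 1 0 = 0 := by
    refine (mul_eq_zero.mp ?_).resolve_right (mul_ne_zero (mul_ne_zero h01 h02) h12)
    linear_combination (x 1 - x 2) * key 0 - (x 0 - x 2) * key 1 + (x 0 - x 1) * key 2
  have e₁ : M 0 0 * N 1 1 + M 0 1 * N 1 0 - N 0 0 * M 1 1 - N 0 1 * M 1 0 = 0 := by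
    refine (mul_eq_zero.mp ?_).resolve_right h01
    linear_combination key 0 - key 1 - (x 0 ^ 2 - x 1 ^ 2) * e₂
  have e₀ : M 0 1 * N 1 1 - N 0 1 * M 1 1 = 0 := by
    linear_combination key 0 - x 0 ^ 2 * e₂ - x 0 * e₁
  refine ⟨(N 1 1 * M 0 0 - N 0 1 * M 1 0) / N.det, ?_⟩
  ext i j
  rw [Matrix.smul_apply, smul_eq_mul, div_mul_eq_mul_div, eq_div_iff hdet, Matrix.det_fin_two]
  fin_cases i <;> fin_cases j <;> simp only [Fin.zero_eta, Fin.mk_one, Fin.isValue]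
  · linear_combination -N 0 1 * e₂
  · linear_combination N 0 0 * e₀ - N 0 1 * e₁
  · linear_combination -N 1 1 * e₂
  · linear_combination N 1 0 * e₀ - N 1 1 * e₁

end MapsPoint

section FormsWithRoots

variable {F : ℂ → ℂ → ℂ} {a : ℂ} {θ : Fin 3 → ℂ}

theorem exists_form_comp_eq_mul (hF : ∀ x y, F x y = a * ∏ i, (x - θ i * y))
    {M : Matrix (Fin 2) (Fin 2) ℂ} (hdet : M.det ≠ 0) {σ : Equiv.Perm (Fin 3)}
    (hM : ∀ i, MapsPoint M (θ i) (θ (σ i))) :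
    ∃ l : ℂ, l ≠ 0 ∧ ∀ x y : ℂ,
      F (M 0 0 * x + M 0 1 * y) (M 1 0 * x + M 1 1 * y) = l * F x y := by
  refine ⟨∏ i, (M 0 0 - θ (σ i) * M 1 0), Finset.prod_ne_zero_iff.mpr fun i _ h => hdet ?_, ?_⟩
  · rw [Matrix.det_fin_two]
    linear_combination (M 1 1 + M 1 0 * θ i) * h - M 1 0 * (hM i).1
  · intro x y
    rw [hF, hF, ← Equiv.prod_comp σ, mul_left_comm, ← Finset.prod_mul_distrib]
    congr 1
    refine Finset.prod_congr rfl fun i _ => ?_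
    linear_combination y * (hM i).1

theorem exists_perm_of_form_comp_eq_mul (ha : a ≠ 0) (hθ : Function.Injective θ)
    (hF : ∀ x y, F x y = a * ∏ i, (x - θ i * y))
    {M : Matrix (Fin 2) (Fin 2) ℂ} (hdet : M.det ≠ 0) {l : ℂ}
    (hM : ∀ x y : ℂ, F (M 0 0 * x + M 0 1 * y) (M 1 0 * x + M 1 1 * y) = l * F x y) :
    ∃ σ : Equiv.Perm (Fin 3), ∀ i, MapsPoint M (θ i) (θ (σ i)) := by
  have hroot (i : Fin 3) : ∃ j, MapsPoint M (θ i) (θ j) := by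
    have h := hM (θ i) 1
    rw [hF (θ i) 1, Finset.prod_eq_zero (Finset.mem_univ i) (by ring), mul_zero, mul_zero, hF,
      mul_eq_zero, Finset.prod_eq_zero_iff] at h
    obtain ⟨j, -, hj⟩ := h.resolve_left ha
    refine ⟨j, by linear_combination hj, fun h0 => hdet ?_⟩
    rw [Matrix.det_fin_two]
    linear_combination (M 0 0 - θ j * M 1 0) * h0 - M 1 0 * hj
  choose s hs using hroot
  have hinj : Function.Injective s := fun i j hij =>
    hθ ((hs i).injective hdet (hij ▸ hs j))
  exact ⟨Equiv.ofBijective s (Finite.injective_iff_bijective.mp hinj), hs⟩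

/-- Matrices realising each permutation of the roots exactly once represent the projective
automorphism group of a form with three simple finite roots. -/
theorem complete_reps_of_forall₂ (ha : a ≠ 0) (hθ : Function.Injective θ)
    (hF : ∀ x y, F x y = a * ∏ i, (x - θ i * y))
    {L : List (Matrix (Fin 2) (Fin 2) ℂ)} {S : List (Equiv.Perm (Fin 3))}
    (hLS : List.Forall₂ (fun M σ => ∀ i, MapsPoint M (θ i) (θ (σ i))) L S)
    (hnodup : S.Nodup) (hS : ∀ σ, σ ∈ S) :
    (∀ M ∈ L, M.det ≠ 0 ∧ ∃ l : ℂ, l ≠ 0 ∧ ∀ x y : ℂ,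
      F (M 0 0 * x + M 0 1 * y) (M 1 0 * x + M 1 1 * y) = l * F x y) ∧
    L.Pairwise (fun M M' => ∀ c : ℂ, M ≠ c • M') ∧
    (∀ T : Matrix (Fin 2) (Fin 2) ℂ, T.det ≠ 0 →
      (∃ l : ℂ, l ≠ 0 ∧ ∀ x y : ℂ,
        F (T 0 0 * x + T 0 1 * y) (T 1 0 * x + T 1 1 * y) = l * F x y) →
      ∃ M ∈ L, ∃ c : ℂ, T = c • M) := by
  have hdet {M : Matrix (Fin 2) (Fin 2) ℂ} {σ : Equiv.Perm (Fin 3)}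
      (h : ∀ i, MapsPoint M (θ i) (θ (σ i))) : M.det ≠ 0 :=
    (h 0).det_ne_zero (h 1) (hθ.ne (σ.injective.ne (by decide)))
  rw [List.forall₂_iff_get] at hLS
  obtain ⟨hlen, hget⟩ := hLS
  simp only [List.get_eq_getElem] at hget
  refine ⟨?_, ?_, ?_⟩
  · intro M hM
    obtain ⟨n, hn, rfl⟩ := List.getElem_of_mem hM
    have h := hget n hn (hlen ▸ hn)
    exact ⟨hdet h, exists_form_comp_eq_mul hF (hdet h) h⟩
  · rw [List.pairwise_iff_getElem]
    intro m n hm hn hmn c hc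
    have hσ : S[m]'(hlen ▸ hm) = S[n]'(hlen ▸ hn) := Equiv.ext fun i =>
      hθ ((hget m hm (hlen ▸ hm) i).eq_of_eq_smul (hget n hn (hlen ▸ hn) i) hc)
    exact hmn.ne ((hnodup.getElem_inj_iff).mp hσ)
  · rintro T hT ⟨l, -, hl⟩
    obtain ⟨σ, hσ⟩ := exists_perm_of_form_comp_eq_mul ha hθ hF hT hl
    obtain ⟨n, hn, rfl⟩ := List.getElem_of_mem (hS σ)
    have h := hget n (hlen ▸ hn) hn
    exact ⟨_, List.getElem_mem (hlen ▸ hn), MapsPoint.eq_smul_of_three hθ (hdet h) hσ h⟩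

end FormsWithRoots

theorem csqrt_sq (z : ℂ) : csqrt z ^ 2 = z := by
  unfold csqrt
  rw [← Complex.cpow_nat_mul]
  norm_num

theorem vieta_of_cubicForm_eq_zero {b₃ b₂ b₁ b₀ p q r : ℂ}
    (hp : cubicForm b₃ b₂ b₁ b₀ p 1 = 0) (hq : cubicForm b₃ b₂ b₁ b₀ q 1 = 0)
    (hr : cubicForm b₃ b₂ b₁ b₀ r 1 = 0) (hpq : p ≠ q) (hpr : p ≠ r) (hqr : q ≠ r) :
    b₂ = -b₃ * (p + q + r) ∧ b₁ = b₃ * (p * q + p * r + q * r) ∧ b₀ = -b₃ * p * q * r := by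
  simp only [cubicForm] at hp hq hr
  have hpq' : b₃ * (p ^ 2 + p * q + q ^ 2) + b₂ * (p + q) + b₁ = 0 := by
    refine (mul_eq_zero.mp ?_).resolve_right (sub_ne_zero.mpr hpq)
    linear_combination hp - hq
  have hpr' : b₃ * (p ^ 2 + p * r + r ^ 2) + b₂ * (p + r) + b₁ = 0 := by
    refine (mul_eq_zero.mp ?_).resolve_right (sub_ne_zero.mpr hpr)
    linear_combination hp - hr
  have h₂ : b₂ + b₃ * (p + q + r) = 0 := by
    refine (mul_eq_zero.mp ?_).resolve_right (sub_ne_zero.mpr hqr)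
    linear_combination hpq' - hpr'
  have h₁ : b₁ - b₃ * (p * q + p * r + q * r) = 0 := by
    linear_combination hpq' - (p + q) * h₂
  refine ⟨by linear_combination h₂, by linear_combination h₁, ?_⟩
  linear_combination hp - p ^ 2 * h₂ - p * h₁

section RootFormulas

variable {b₃ b₂ b₁ b₀ p q r : ℂ}

theorem cubicDisc_eq (h₂ : b₂ = -b₃ * (p + q + r)) (h₁ : b₁ = b₃ * (p * q + p * r + q * r))
    (h₀ : b₀ = -b₃ * p * q * r) :
    cubicDisc b₃ b₂ b₁ b₀ = (b₃ ^ 2 * ((p - q) * (q - r) * (p - r))) ^ 2 := by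
  subst h₂ h₁ h₀
  unfold cubicDisc
  ring

theorem Tmat_mapsPoint (hb₃ : b₃ ≠ 0) (hpq : p ≠ q) (hpr : p ≠ r) (hqr : q ≠ r)
    (h₂ : b₂ = -b₃ * (p + q + r)) (h₁ : b₁ = b₃ * (p * q + p * r + q * r))
    (h₀ : b₀ = -b₃ * p * q * r) :
    MapsPoint (Tmat b₃ b₂ b₁ b₀ p) p p ∧ MapsPoint (Tmat b₃ b₂ b₁ b₀ p) q r ∧
      MapsPoint (Tmat b₃ b₂ b₁ b₀ p) r q := by
  have hpq' := sub_ne_zero.mpr hpq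
  have hpr' := sub_ne_zero.mpr hpr
  have hqr' := sub_ne_zero.mpr hqr
  have hΔ : -(6 * cubicDisc b₃ b₂ b₁ b₀)⁻¹ ≠ 0 := by
    rw [cubicDisc_eq h₂ h₁ h₀]
    simp [hb₃, hpq', hpr', hqr']
  subst h₂ h₁ h₀
  refine ⟨.smul hΔ ⟨?_, ?_⟩, .smul hΔ ⟨?_, ?_⟩, .smul hΔ ⟨?_, ?_⟩⟩ <;>
    simp only [Mmat, Matrix.mul_apply, Fin.sum_univ_two, Matrix.of_apply, Matrix.cons_val',
      Matrix.cons_val_zero, Matrix.cons_val_one, Matrix.cons_val_fin_one]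
  · ring
  · have : 6 * b₃ ^ 4 * (p - q) ^ 2 * (q - r) ^ 2 * (p - r) ^ 2 ≠ 0 := by
      simp [hb₃, hpq', hpr', hqr']
    convert this using 1
    ring
  · ring
  · have : -6 * b₃ ^ 4 * (p - q) ^ 3 * (q - r) ^ 2 * (p - r) ≠ 0 := by
      simp [hb₃, hpq', hpr', hqr']
    convert this using 1
    ring
  · ring
  · have : -6 * b₃ ^ 4 * (p - q) * (q - r) ^ 2 * (p - r) ^ 3 ≠ 0 := by
      simp [hb₃, hpq', hpr', hqr']
    convert this using 1
    ring

theorem NqF_mapsPoint (hb₃ : b₃ ≠ 0) (hpq : p ≠ q) (hpr : p ≠ r) (hqr : q ≠ r)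
    (h₂ : b₂ = -b₃ * (p + q + r)) (h₁ : b₁ = b₃ * (p * q + p * r + q * r))
    (h₀ : b₀ = -b₃ * p * q * r)
    (hs : csqrt (-3 * ((b₂ * b₁ - 9 * b₃ * b₀) ^ 2
        - 4 * (b₂ ^ 2 - 3 * b₃ * b₁) * (b₁ ^ 2 - 3 * b₂ * b₀)))
      = 3 * b₃ ^ 2 * ((p - q) * (q - r) * (p - r))) :
    MapsPoint (NqF b₃ b₂ b₁ b₀) p r ∧ MapsPoint (NqF b₃ b₂ b₁ b₀) q p ∧
      MapsPoint (NqF b₃ b₂ b₁ b₀) r q := by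
  have hpq' := sub_ne_zero.mpr hpq
  have hpr' := sub_ne_zero.mpr hpr
  have hqr' := sub_ne_zero.mpr hqr
  have hΔ : (2 * ((b₂ * b₁ - 9 * b₃ * b₀) ^ 2
        - 4 * (b₂ ^ 2 - 3 * b₃ * b₁) * (b₁ ^ 2 - 3 * b₂ * b₀)))⁻¹ ≠ 0 := by
    have : -6 * (b₃ ^ 2 * ((p - q) * (q - r) * (p - r))) ^ 2 ≠ 0 := by
      simp [hb₃, hpq', hpr', hqr']
    refine inv_ne_zero ?_
    convert this using 1
    subst h₂ h₁ h₀
    ring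
  unfold NqF Nmat
  rw [hs]
  clear hs
  subst h₂ h₁ h₀
  refine ⟨.smul hΔ ⟨?_, ?_⟩, .smul hΔ ⟨?_, ?_⟩, .smul hΔ ⟨?_, ?_⟩⟩ <;>
    simp only [Matrix.of_apply, Matrix.cons_val',
      Matrix.cons_val_zero, Matrix.cons_val_one, Matrix.cons_val_fin_one]
  · ring
  · have : -6 * b₃ ^ 4 * (p - q) ^ 3 * (q - r) * (p - r) ^ 2 ≠ 0 := by
      simp [hb₃, hpq', hpr', hqr']
    convert this using 1
    ring
  · ring
  · have : 6 * b₃ ^ 4 * (p - q) ^ 2 * (q - r) ^ 3 * (p - r) ≠ 0 := by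
      simp [hb₃, hpq', hpr', hqr']
    convert this using 1
    ring
  · ring
  · have : 6 * b₃ ^ 4 * (p - q) * (q - r) ^ 2 * (p - r) ^ 3 ≠ 0 := by
      simp [hb₃, hpq', hpr', hqr']
    convert this using 1
    ring

/-- `𝒩_{q_F}` permutes the roots of `F` cyclically; the direction depends on the square root. -/
theorem NqF_cyclic (hb₃ : b₃ ≠ 0) (hpq : p ≠ q) (hpr : p ≠ r) (hqr : q ≠ r)
    (h₂ : b₂ = -b₃ * (p + q + r)) (h₁ : b₁ = b₃ * (p * q + p * r + q * r))
    (h₀ : b₀ = -b₃ * p * q * r) :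
    (MapsPoint (NqF b₃ b₂ b₁ b₀) p r ∧ MapsPoint (NqF b₃ b₂ b₁ b₀) q p ∧
      MapsPoint (NqF b₃ b₂ b₁ b₀) r q) ∨
    (MapsPoint (NqF b₃ b₂ b₁ b₀) p q ∧ MapsPoint (NqF b₃ b₂ b₁ b₀) r p ∧
      MapsPoint (NqF b₃ b₂ b₁ b₀) q r) := by
  have hsq := csqrt_sq (-3 * ((b₂ * b₁ - 9 * b₃ * b₀) ^ 2
        - 4 * (b₂ ^ 2 - 3 * b₃ * b₁) * (b₁ ^ 2 - 3 * b₂ * b₀)))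
  have hdisc : -3 * ((b₂ * b₁ - 9 * b₃ * b₀) ^ 2
        - 4 * (b₂ ^ 2 - 3 * b₃ * b₁) * (b₁ ^ 2 - 3 * b₂ * b₀))
      = (3 * b₃ ^ 2 * ((p - q) * (q - r) * (p - r))) ^ 2 := by
    subst h₂ h₁ h₀
    ring
  rcases sq_eq_sq_iff_eq_or_eq_neg.mp (hsq.trans hdisc) with hs | hs
  · exact .inl (NqF_mapsPoint hb₃ hpq hpr hqr h₂ h₁ h₀ hs)
  · refine .inr (NqF_mapsPoint hb₃ hpr hpq hqr.symm ?_ ?_ ?_ ?_)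
    · rw [h₂]; ring
    · rw [h₁]; ring
    · rw [h₀]; ring
    · rw [hs]; ring

end RootFormulas

/-- For a binary cubic form `F` with complex coefficients, non-zero discriminant and non-zero
`x³`-coefficient, with roots `θ₁, θ₂, θ₃` of `F(x,1)`, the six matrices
`I, 𝒯_{θ₁}, 𝒯_{θ₂}, 𝒯_{θ₃}, 𝒩_{q_F}, 𝒩_{q_F}²` form a complete set of representatives in
`GL₂(ℂ)` of `Aut*_ℂ F ⊆ PGL₂(ℂ)`: each is non-singular and fixes `F` up to a non-zero
scalar, they are pairwise non-proportional, and every non-singular matrix fixing `F` up to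
a non-zero scalar is proportional to one of them. -/
theorem cubic_projective_automorphism_reps (b₃ b₂ b₁ b₀ θ₁ θ₂ θ₃ : ℂ) (hb₃ : b₃ ≠ 0)
    (hΔ : cubicDisc b₃ b₂ b₁ b₀ ≠ 0)
    (h₁ : cubicForm b₃ b₂ b₁ b₀ θ₁ 1 = 0) (h₂ : cubicForm b₃ b₂ b₁ b₀ θ₂ 1 = 0)
    (h₃ : cubicForm b₃ b₂ b₁ b₀ θ₃ 1 = 0)
    (h12 : θ₁ ≠ θ₂) (h13 : θ₁ ≠ θ₃) (h23 : θ₂ ≠ θ₃) :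
    (∀ M ∈ [(1 : Matrix (Fin 2) (Fin 2) ℂ), Tmat b₃ b₂ b₁ b₀ θ₁, Tmat b₃ b₂ b₁ b₀ θ₂,
        Tmat b₃ b₂ b₁ b₀ θ₃, NqF b₃ b₂ b₁ b₀, NqF b₃ b₂ b₁ b₀ ^ 2],
      M.det ≠ 0 ∧ ∃ l : ℂ, l ≠ 0 ∧ ∀ x y : ℂ,
        cubicForm b₃ b₂ b₁ b₀ (M 0 0 * x + M 0 1 * y) (M 1 0 * x + M 1 1 * y)
          = l * cubicForm b₃ b₂ b₁ b₀ x y) ∧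
    List.Pairwise (fun M M' : Matrix (Fin 2) (Fin 2) ℂ => ∀ c : ℂ, M ≠ c • M')
      [(1 : Matrix (Fin 2) (Fin 2) ℂ), Tmat b₃ b₂ b₁ b₀ θ₁, Tmat b₃ b₂ b₁ b₀ θ₂,
        Tmat b₃ b₂ b₁ b₀ θ₃, NqF b₃ b₂ b₁ b₀, NqF b₃ b₂ b₁ b₀ ^ 2] ∧
    (∀ T : Matrix (Fin 2) (Fin 2) ℂ, T.det ≠ 0 →
      (∃ l : ℂ, l ≠ 0 ∧ ∀ x y : ℂ,
        cubicForm b₃ b₂ b₁ b₀ (T 0 0 * x + T 0 1 * y) (T 1 0 * x + T 1 1 * y)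
          = l * cubicForm b₃ b₂ b₁ b₀ x y) →
      ∃ M ∈ [(1 : Matrix (Fin 2) (Fin 2) ℂ), Tmat b₃ b₂ b₁ b₀ θ₁, Tmat b₃ b₂ b₁ b₀ θ₂,
        Tmat b₃ b₂ b₁ b₀ θ₃, NqF b₃ b₂ b₁ b₀, NqF b₃ b₂ b₁ b₀ ^ 2],
        ∃ c : ℂ, T = c • M) := by
  obtain ⟨e₂, e₁, e₀⟩ := vieta_of_cubicForm_eq_zero h₁ h₂ h₃ h12 h13 h23
  have hθ : Function.Injective ![θ₁, θ₂, θ₃] := by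
    intro i j
    fin_cases i <;> fin_cases j <;> simp [h12, h13, h23, h12.symm, h13.symm, h23.symm]
  have hF (x y : ℂ) : cubicForm b₃ b₂ b₁ b₀ x y
      = b₃ * ∏ i, (x - ![θ₁, θ₂, θ₃] i * y) := by
    rw [Fin.prod_univ_three, e₂, e₁, e₀]
    simp only [cubicForm, Matrix.cons_val]
    ring
  obtain ⟨t₁₁, t₁₂, t₁₃⟩ := Tmat_mapsPoint hb₃ h12 h13 h23 e₂ e₁ e₀
  obtain ⟨t₂₂, t₂₁, t₂₃⟩ := Tmat_mapsPoint (b₂ := b₂) (b₁ := b₁) (b₀ := b₀) hb₃ h12.symm h23 h13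
    (by linear_combination e₂) (by linear_combination e₁) (by linear_combination e₀)
  obtain ⟨t₃₃, t₃₁, t₃₂⟩ := Tmat_mapsPoint (b₂ := b₂) (b₁ := b₁) (b₀ := b₀) hb₃ h13.symm
    h23.symm h12
    (by linear_combination e₂) (by linear_combination e₁) (by linear_combination e₀)
  have reps {σ : Equiv.Perm (Fin 3)} (hσ : σ = finRotate 3 ∨ σ = (finRotate 3)⁻¹)
      (hN : ∀ i, MapsPoint (NqF b₃ b₂ b₁ b₀) (![θ₁, θ₂, θ₃] i) (![θ₁, θ₂, θ₃] (σ i))) :=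
    complete_reps_of_forall₂ (F := cubicForm b₃ b₂ b₁ b₀) hb₃ hθ hF
      (L := [1, Tmat b₃ b₂ b₁ b₀ θ₁, Tmat b₃ b₂ b₁ b₀ θ₂, Tmat b₃ b₂ b₁ b₀ θ₃,
        NqF b₃ b₂ b₁ b₀, NqF b₃ b₂ b₁ b₀ ^ 2])
      (S := [1, Equiv.swap 1 2, Equiv.swap 0 2, Equiv.swap 0 1, σ, σ * σ])
      (.cons (fun i => .one _) <|
        .cons (Fin.forall_fin_succ.mpr ⟨t₁₁, Fin.forall_fin_two.mpr ⟨t₁₂, t₁₃⟩⟩) <|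
        .cons (Fin.forall_fin_succ.mpr ⟨t₂₁, Fin.forall_fin_two.mpr ⟨t₂₂, t₂₃⟩⟩) <|
        .cons (Fin.forall_fin_succ.mpr ⟨t₃₁, Fin.forall_fin_two.mpr ⟨t₃₂, t₃₃⟩⟩) <|
        .cons hN <|
        .cons (fun i => by
          rw [pow_two]
          exact (hN (σ i)).mul (hN i)) .nil)
      (by rcases hσ with rfl | rfl <;> decide) (by rcases hσ with rfl | rfl <;> decide)
  rcases NqF_cyclic hb₃ h12 h13 h23 e₂ e₁ e₀ with ⟨n₁, n₂, n₃⟩ | ⟨n₁, n₃, n₂⟩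
  · exact reps (.inr rfl) (Fin.forall_fin_succ.mpr ⟨n₁, Fin.forall_fin_two.mpr ⟨n₂, n₃⟩⟩)
  · exact reps (.inl rfl) (Fin.forall_fin_succ.mpr ⟨n₁, Fin.forall_fin_two.mpr ⟨n₂, n₃⟩⟩)
end

section
/- Let F be a binary quartic form with complex coefficients and non-zero discriminant. Then its sextic covariant F₆ is a Klein form with non-zero discriminant. -/
/-- The coefficients `g₆, g₅, …, g₀` of the sextic covariant `F₆` of the binary quartic form
`F = a₄x⁴ + a₃x³y + a₂x²y² + a₁xy³ + a₀y⁴`. -/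
noncomputable def sexticCov (a₄ a₃ a₂ a₁ a₀ : ℂ) : Fin 7 → ℂ :=
  ![-(a₁ ^ 3 + 8 * a₃ * a₀ ^ 2 - 4 * a₂ * a₁ * a₀),                      -- g₀
    -(2 * (16 * a₄ * a₀ ^ 2 + 2 * a₃ * a₁ * a₀ - 4 * a₂ ^ 2 * a₀ + a₂ * a₁ ^ 2)), -- g₁
    -(5 * (8 * a₄ * a₁ * a₀ + a₃ * a₁ ^ 2 - 4 * a₃ * a₂ * a₀)),           -- g₂
    20 * (a₃ ^ 2 * a₀ - a₄ * a₁ ^ 2),                                     -- g₃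
    5 * (8 * a₄ * a₃ * a₀ + a₃ ^ 2 * a₁ - 4 * a₄ * a₂ * a₁),              -- g₄
    2 * (16 * a₄ ^ 2 * a₀ + 2 * a₄ * a₃ * a₁ - 4 * a₄ * a₂ ^ 2 + a₃ ^ 2 * a₂), -- g₅
    a₃ ^ 3 + 8 * a₄ ^ 2 * a₁ - 4 * a₄ * a₃ * a₂]                          -- g₆

/-- A binary sextic form `g₆x⁶ + g₅x⁵y + ⋯ + g₀y⁶` (coefficient `g i` on `xⁱy⁶⁻ⁱ`) is a
Klein form if its coefficients satisfy the three quadratic Klein relations. -/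
def IsKleinForm (g : Fin 7 → ℂ) : Prop :=
  10 * g 6 * g 2 - 5 * g 5 * g 3 + 2 * g 4 ^ 2 = 0 ∧
  25 * g 6 * g 1 - 5 * g 5 * g 2 + g 3 * g 4 = 0 ∧
  50 * g 6 * g 0 - 2 * g 2 * g 4 + g 3 ^ 2 = 0

/-- A binary sextic form has non-zero discriminant iff it factors over `ℂ` as a non-zero
constant times a product of six pairwise non-proportional linear forms. -/
def SexticNonzeroDisc (g : Fin 7 → ℂ) : Prop :=
  ∃ (c : ℂ) (L : Fin 6 → ℂ × ℂ), c ≠ 0 ∧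
    (∀ i j : Fin 6, i ≠ j → (L i).1 * (L j).2 - (L j).1 * (L i).2 ≠ 0) ∧
    ∀ x y : ℂ, (∑ i : Fin 7, g i * x ^ (i : ℕ) * y ^ (6 - (i : ℕ)))
      = c * ∏ j : Fin 6, ((L j).1 * x + (L j).2 * y)

/-- A complex quadratic form is a product of two linear forms. -/
lemma exists_factor_quadratic (a₂ a₁ a₀ : ℂ) : ∃ p₁ q₁ p₂ q₂ : ℂ,
    a₂ = p₁ * p₂ ∧ a₁ = p₁ * q₂ + q₁ * p₂ ∧ a₀ = q₁ * q₂ := by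
  by_cases h : a₂ = 0
  · exact ⟨0, 1, a₁, a₀, by simp [h], by simp, by simp⟩
  · obtain ⟨r, hr⟩ := IsAlgClosed.exists_root (Polynomial.C a₂ * Polynomial.X ^ 2 +
      Polynomial.C a₁ * Polynomial.X + Polynomial.C a₀)
      (by rw [Polynomial.degree_quadratic h]; decide)
    simp only [Polynomial.IsRoot, Polynomial.eval_add, Polynomial.eval_mul, Polynomial.eval_C,
      Polynomial.eval_pow, Polynomial.eval_X] at hr
    exact ⟨1, -r, a₂, a₁ + a₂ * r, by ring, by ring, by linear_combination hr⟩

/-- A complex quartic form is the product of a linear form and a cubic form. -/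
lemma exists_linear_factor_quartic (a₄ a₃ a₂ a₁ a₀ : ℂ) : ∃ p q b₃ b₂ b₁ b₀ : ℂ,
    a₄ = p * b₃ ∧ a₃ = p * b₂ + q * b₃ ∧ a₂ = p * b₁ + q * b₂ ∧ a₁ = p * b₀ + q * b₁ ∧
      a₀ = q * b₀ := by
  by_cases h : a₄ = 0
  · exact ⟨0, 1, a₃, a₂, a₁, a₀, by simp [h], by simp, by simp, by simp, by simp⟩
  · obtain ⟨r, hr⟩ := IsAlgClosed.exists_root (Polynomial.C a₄ * Polynomial.X ^ 4 +
      (Polynomial.C a₃ * Polynomial.X ^ 3 + Polynomial.C a₂ * Polynomial.X ^ 2 +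
      Polynomial.C a₁ * Polynomial.X + Polynomial.C a₀))
      (by
        have hlt : (Polynomial.C a₃ * Polynomial.X ^ 3 + Polynomial.C a₂ * Polynomial.X ^ 2 +
            Polynomial.C a₁ * Polynomial.X + Polynomial.C a₀).degree <
            (Polynomial.C a₄ * Polynomial.X ^ 4).degree := by
          rw [Polynomial.degree_C_mul_X_pow 4 h]
          exact Polynomial.degree_cubic_le.trans_lt (by decide)
        rw [Polynomial.degree_add_eq_left_of_degree_lt hlt, Polynomial.degree_C_mul_X_pow 4 h]
        decide)
    simp only [Polynomial.IsRoot, Polynomial.eval_add, Polynomial.eval_mul, Polynomial.eval_C,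
      Polynomial.eval_pow, Polynomial.eval_X] at hr
    exact ⟨1, -r, a₄, a₃ + a₄ * r, a₂ + a₃ * r + a₄ * r ^ 2,
      a₁ + a₂ * r + a₃ * r ^ 2 + a₄ * r ^ 3, by ring, by ring, by ring, by ring,
      by linear_combination hr⟩

/-- A complex cubic form is the product of a linear form and a quadratic form. -/
lemma exists_linear_factor_cubic (a₃ a₂ a₁ a₀ : ℂ) : ∃ p q b₂ b₁ b₀ : ℂ,
    a₃ = p * b₂ ∧ a₂ = p * b₁ + q * b₂ ∧ a₁ = p * b₀ + q * b₁ ∧ a₀ = q * b₀ := by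
  by_cases h : a₃ = 0
  · exact ⟨0, 1, a₂, a₁, a₀, by simp [h], by simp, by simp, by simp⟩
  · obtain ⟨r, hr⟩ := IsAlgClosed.exists_root (Polynomial.C a₃ * Polynomial.X ^ 3 +
      Polynomial.C a₂ * Polynomial.X ^ 2 + Polynomial.C a₁ * Polynomial.X + Polynomial.C a₀)
      (by rw [Polynomial.degree_cubic h]; decide)
    simp only [Polynomial.IsRoot, Polynomial.eval_add, Polynomial.eval_mul, Polynomial.eval_C,
      Polynomial.eval_pow, Polynomial.eval_X] at hr
    exact ⟨1, -r, a₃, a₂ + a₃ * r, a₁ + a₂ * r + a₃ * r ^ 2, by ring, by ring, by ring,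
      by linear_combination hr⟩

/-- A complex quartic form is a product of two quadratic forms, each a product of two linear
forms. -/
lemma exists_factor_quartic (a₄ a₃ a₂ a₁ a₀ : ℂ) : ∃ p₁ q₁ p₂ q₂ p₃ q₃ p₄ q₄ : ℂ,
    a₄ = p₁ * p₂ * (p₃ * p₄) ∧
    a₃ = p₁ * p₂ * (p₃ * q₄ + q₃ * p₄) + (p₁ * q₂ + q₁ * p₂) * (p₃ * p₄) ∧
    a₂ = p₁ * p₂ * (q₃ * q₄) + (p₁ * q₂ + q₁ * p₂) * (p₃ * q₄ + q₃ * p₄)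
      + q₁ * q₂ * (p₃ * p₄) ∧
    a₁ = (p₁ * q₂ + q₁ * p₂) * (q₃ * q₄) + q₁ * q₂ * (p₃ * q₄ + q₃ * p₄) ∧
    a₀ = q₁ * q₂ * (q₃ * q₄) := by
  obtain ⟨p₁, q₁, b₃, b₂, b₁, b₀, rfl, rfl, rfl, rfl, rfl⟩ :=
    exists_linear_factor_quartic a₄ a₃ a₂ a₁ a₀
  obtain ⟨p₂, q₂, c₂, c₁, c₀, rfl, rfl, rfl, rfl⟩ := exists_linear_factor_cubic b₃ b₂ b₁ b₀
  obtain ⟨p₃, q₃, p₄, q₄, rfl, rfl, rfl⟩ := exists_factor_quadratic c₂ c₁ c₀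
  exact ⟨p₁, q₁, p₂, q₂, p₃, q₃, p₄, q₄, by ring, by ring, by ring, by ring, by ring⟩

/-- The polarization of the discriminant of quadratic forms: its value at `(f, f)` is the
discriminant of `f = f₂x² + f₁xy + f₀y²`, where `f = (f₂, f₁, f₀)`. -/
def quadraticPairing (f g : ℂ × ℂ × ℂ) : ℂ :=
  f.2.1 * g.2.1 - 2 * (f.1 * g.2.2 + f.2.2 * g.1)

/-- The value at `(x, y)` of the quadratic form with coefficients `f = (f₂, f₁, f₀)`. -/
def quadraticEval (f : ℂ × ℂ × ℂ) (x y : ℂ) : ℂ :=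
  f.1 * x ^ 2 + f.2.1 * x * y + f.2.2 * y ^ 2

/-- The Jacobian (up to a factor of two) of `(p₁x + q₁y)(p₂x + q₂y)` and
`(p₃x + q₃y)(p₄x + q₄y)`. -/
def jacobianPair (p₁ q₁ p₂ q₂ p₃ q₃ p₄ q₄ : ℂ) : ℂ × ℂ × ℂ :=
  (p₁ * p₂ * (p₃ * q₄ + q₃ * p₄) - (p₁ * q₂ + q₁ * p₂) * (p₃ * p₄),
    2 * (p₁ * p₂ * (q₃ * q₄) - q₁ * q₂ * (p₃ * p₄)),
    (p₁ * q₂ + q₁ * p₂) * (q₃ * q₄) - q₁ * q₂ * (p₃ * q₄ + q₃ * p₄))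

lemma quadraticPairing_jacobianPair_self (p₁ q₁ p₂ q₂ p₃ q₃ p₄ q₄ : ℂ) :
    quadraticPairing (jacobianPair p₁ q₁ p₂ q₂ p₃ q₃ p₄ q₄)
      (jacobianPair p₁ q₁ p₂ q₂ p₃ q₃ p₄ q₄) =
    4 * ((p₁ * q₃ - p₃ * q₁) * (p₁ * q₄ - p₄ * q₁) *
      ((p₂ * q₃ - p₃ * q₂) * (p₂ * q₄ - p₄ * q₂))) := by
  simp only [quadraticPairing, jacobianPair]
  ring

/-- Orthogonal quadratic forms of non-zero discriminant have no common linear factor. -/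
lemma cross_ne_zero_of_quadraticPairing {p₁ q₁ p₂ q₂ r₁ s₁ r₂ s₂ : ℂ}
    {f g : ℂ × ℂ × ℂ} (hf : f = (p₁ * p₂, p₁ * q₂ + q₁ * p₂, q₁ * q₂))
    (hg : g = (r₁ * r₂, r₁ * s₂ + s₁ * r₂, s₁ * s₂))
    (hff : quadraticPairing f f ≠ 0) (hgg : quadraticPairing g g ≠ 0)
    (hfg : quadraticPairing f g = 0) :
    (p₁ * s₁ ≠ r₁ * q₁ ∧ p₁ * s₂ ≠ r₂ * q₁) ∧ (p₂ * s₁ ≠ r₁ * q₂ ∧ p₂ * s₂ ≠ r₂ * q₂) := by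
  have key : quadraticPairing f f * quadraticPairing g g - quadraticPairing f g ^ 2 =
      -4 * (((p₁ * s₁ - r₁ * q₁) * (p₁ * s₂ - r₂ * q₁)) *
        ((p₂ * s₁ - r₁ * q₂) * (p₂ * s₂ - r₂ * q₂))) := by
    subst hf hg
    simp only [quadraticPairing]
    ring
  have hne : quadraticPairing f f * quadraticPairing g g - quadraticPairing f g ^ 2 ≠ 0 := by
    simpa [hfg] using And.intro hff hgg
  rw [key] at hne
  simpa only [mul_ne_zero_iff, sub_ne_zero] using (mul_ne_zero_iff.mp hne).2

lemma cross_ne_zero_of_quadraticPairing_self {p₁ q₁ p₂ q₂ : ℂ} {f : ℂ × ℂ × ℂ}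
    (hf : f = (p₁ * p₂, p₁ * q₂ + q₁ * p₂, q₁ * q₂)) (hff : quadraticPairing f f ≠ 0) :
    p₁ * q₂ ≠ p₂ * q₁ := by
  intro h
  apply hff
  subst hf
  simp only [quadraticPairing]
  linear_combination (p₁ * q₂ - p₂ * q₁) * h

/-- A product of three pairwise orthogonal quadratic forms of non-zero discriminant has non-zero
discriminant. -/
lemma sexticNonzeroDisc_of_quadratics {G : Fin 7 → ℂ} {f g h : ℂ × ℂ × ℂ} {c : ℂ} (hc : c ≠ 0)
    (hff : quadraticPairing f f ≠ 0) (hgg : quadraticPairing g g ≠ 0)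
    (hhh : quadraticPairing h h ≠ 0) (hfg : quadraticPairing f g = 0)
    (hfh : quadraticPairing f h = 0) (hgh : quadraticPairing g h = 0)
    (hG : ∀ x y : ℂ, (∑ i : Fin 7, G i * x ^ (i : ℕ) * y ^ (6 - (i : ℕ))) =
      c * (quadraticEval f x y * quadraticEval g x y * quadraticEval h x y)) :
    SexticNonzeroDisc G := by
  have factor : ∀ f : ℂ × ℂ × ℂ, ∃ p₁ q₁ p₂ q₂ : ℂ,
      f = (p₁ * p₂, p₁ * q₂ + q₁ * p₂, q₁ * q₂) := by
    rintro ⟨a₂, a₁, a₀⟩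
    obtain ⟨p₁, q₁, p₂, q₂, rfl, rfl, rfl⟩ := exists_factor_quadratic a₂ a₁ a₀
    exact ⟨p₁, q₁, p₂, q₂, rfl⟩
  obtain ⟨p₁, q₁, p₂, q₂, hf⟩ := factor f
  obtain ⟨p₃, q₃, p₄, q₄, hg⟩ := factor g
  obtain ⟨p₅, q₅, p₆, q₆, hh⟩ := factor h
  have d₁ := cross_ne_zero_of_quadraticPairing_self hf hff
  have d₂ := cross_ne_zero_of_quadraticPairing_self hg hgg
  have d₃ := cross_ne_zero_of_quadraticPairing_self hh hhh
  obtain ⟨⟨e₁, e₂⟩, e₃, e₄⟩ := cross_ne_zero_of_quadraticPairing hf hg hff hgg hfg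
  obtain ⟨⟨e₅, e₆⟩, e₇, e₈⟩ := cross_ne_zero_of_quadraticPairing hf hh hff hhh hfh
  obtain ⟨⟨k₁, k₂⟩, k₃, k₄⟩ := cross_ne_zero_of_quadraticPairing hg hh hgg hhh hgh
  refine ⟨c, ![(p₁, q₁), (p₂, q₂), (p₃, q₃), (p₄, q₄), (p₅, q₅), (p₆, q₆)], hc, ?_, ?_⟩
  · intro i j hij
    rw [sub_ne_zero]
    fin_cases i <;> fin_cases j <;>
      first
        | exact absurd rfl hij
        | assumption
        | (apply Ne.symm; assumption)
  · intro x y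
    rw [hG, hf, hg, hh]
    simp only [quadraticEval, Fin.prod_univ_six, Matrix.cons_val]
    ring

/-- The sextic covariant of a product of four linear forms is, up to sign, the product of the
Jacobians attached to the three ways of splitting the linear forms into pairs. -/
lemma sum_sexticCov_eq_jacobianPair {a₄ a₃ a₂ a₁ a₀ p₁ q₁ p₂ q₂ p₃ q₃ p₄ q₄ : ℂ}
    (h₄ : a₄ = p₁ * p₂ * (p₃ * p₄))
    (h₃ : a₃ = p₁ * p₂ * (p₃ * q₄ + q₃ * p₄) + (p₁ * q₂ + q₁ * p₂) * (p₃ * p₄))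
    (h₂ : a₂ = p₁ * p₂ * (q₃ * q₄) + (p₁ * q₂ + q₁ * p₂) * (p₃ * q₄ + q₃ * p₄)
      + q₁ * q₂ * (p₃ * p₄))
    (h₁ : a₁ = (p₁ * q₂ + q₁ * p₂) * (q₃ * q₄) + q₁ * q₂ * (p₃ * q₄ + q₃ * p₄))
    (h₀ : a₀ = q₁ * q₂ * (q₃ * q₄)) (x y : ℂ) :
    (∑ i : Fin 7, sexticCov a₄ a₃ a₂ a₁ a₀ i * x ^ (i : ℕ) * y ^ (6 - (i : ℕ))) =
      (-1) * (quadraticEval (jacobianPair p₁ q₁ p₂ q₂ p₃ q₃ p₄ q₄) x y *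
        quadraticEval (jacobianPair p₁ q₁ p₃ q₃ p₂ q₂ p₄ q₄) x y *
        quadraticEval (jacobianPair p₁ q₁ p₄ q₄ p₂ q₂ p₃ q₃) x y) := by
  subst h₄ h₃ h₂ h₁ h₀
  simp [Fin.sum_univ_seven, sexticCov, quadraticEval, jacobianPair]
  ring

/-- The linear factors of a quartic form of non-zero discriminant are pairwise
non-proportional. -/
lemma cross_ne_zero_of_quarticDisc {a₄ a₃ a₂ a₁ a₀ p₁ q₁ p₂ q₂ p₃ q₃ p₄ q₄ : ℂ}
    (h₄ : a₄ = p₁ * p₂ * (p₃ * p₄))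
    (h₃ : a₃ = p₁ * p₂ * (p₃ * q₄ + q₃ * p₄) + (p₁ * q₂ + q₁ * p₂) * (p₃ * p₄))
    (h₂ : a₂ = p₁ * p₂ * (q₃ * q₄) + (p₁ * q₂ + q₁ * p₂) * (p₃ * q₄ + q₃ * p₄)
      + q₁ * q₂ * (p₃ * p₄))
    (h₁ : a₁ = (p₁ * q₂ + q₁ * p₂) * (q₃ * q₄) + q₁ * q₂ * (p₃ * q₄ + q₃ * p₄))
    (h₀ : a₀ = q₁ * q₂ * (q₃ * q₄)) (hΔ : quarticDisc a₄ a₃ a₂ a₁ a₀ ≠ 0) :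
    ((p₁ * q₂ - p₂ * q₁ ≠ 0 ∧ p₃ * q₄ - p₄ * q₃ ≠ 0) ∧
      (p₁ * q₃ - p₃ * q₁ ≠ 0 ∧ p₂ * q₄ - p₄ * q₂ ≠ 0)) ∧
      (p₁ * q₄ - p₄ * q₁ ≠ 0 ∧ p₂ * q₃ - p₃ * q₂ ≠ 0) := by
  obtain ⟨U, hU⟩ : ∃ U, U = (p₁ * q₂ - p₂ * q₁) * (p₃ * q₄ - p₄ * q₃) := ⟨_, rfl⟩
  obtain ⟨V, hV⟩ : ∃ V, V = (p₁ * q₃ - p₃ * q₁) * (p₂ * q₄ - p₄ * q₂) := ⟨_, rfl⟩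
  obtain ⟨W, hW⟩ : ∃ W, W = (p₁ * q₄ - p₄ * q₁) * (p₂ * q₃ - p₃ * q₂) := ⟨_, rfl⟩
  have hVW : V = U + W := by rw [hU, hV, hW]; ring
  have hI : quarticI a₄ a₃ a₂ a₁ a₀ = U ^ 2 + U * W + W ^ 2 := by
    rw [hU, hW, quarticI, h₄, h₃, h₂, h₁, h₀]; ring
  have hJ : quarticJ a₄ a₃ a₂ a₁ a₀ = (2 * U + W) * (U + 2 * W) * (U - W) := by
    rw [hU, hW, quarticJ, h₄, h₃, h₂, h₁, h₀]; ring
  have hD : quarticDisc a₄ a₃ a₂ a₁ a₀ = (U * V * W) ^ 2 := by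
    rw [quarticDisc, hI, hJ, hVW]; ring
  rw [hD, hU, hV, hW] at hΔ
  simpa only [mul_ne_zero_iff] using (pow_ne_zero_iff two_ne_zero).mp hΔ

/-- The sextic covariant `F₆` of a binary quartic form with complex coefficients and
non-zero discriminant is a Klein form with non-zero discriminant. -/
theorem sexticCov_isKleinForm (a₄ a₃ a₂ a₁ a₀ : ℂ)
    (hΔ : quarticDisc a₄ a₃ a₂ a₁ a₀ ≠ 0) :
    IsKleinForm (sexticCov a₄ a₃ a₂ a₁ a₀) ∧
      SexticNonzeroDisc (sexticCov a₄ a₃ a₂ a₁ a₀) := by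
  constructor
  · simp only [IsKleinForm, sexticCov, Matrix.cons_val]
    refine ⟨?_, ?_, ?_⟩ <;> ring
  · obtain ⟨p₁, q₁, p₂, q₂, p₃, q₃, p₄, q₄, h₄, h₃, h₂, h₁, h₀⟩ :=
      exists_factor_quartic a₄ a₃ a₂ a₁ a₀
    obtain ⟨⟨⟨h₁₂, h₃₄⟩, h₁₃, h₂₄⟩, h₁₄, h₂₃⟩ := cross_ne_zero_of_quarticDisc h₄ h₃ h₂ h₁ h₀ hΔ
    have h₃₂ : p₃ * q₂ - p₂ * q₃ ≠ 0 := fun h => h₂₃ (by linear_combination -h)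
    have h₄₂ : p₄ * q₂ - p₂ * q₄ ≠ 0 := fun h => h₂₄ (by linear_combination -h)
    have h₄₃ : p₄ * q₃ - p₃ * q₄ ≠ 0 := fun h => h₃₄ (by linear_combination -h)
    refine sexticNonzeroDisc_of_quadratics (c := (-1)) (by norm_num) ?_ ?_ ?_ ?_ ?_ ?_
      (sum_sexticCov_eq_jacobianPair h₄ h₃ h₂ h₁ h₀)
    iterate 3
      rw [quadraticPairing_jacobianPair_self]
      simp only [ne_eq, mul_eq_zero, not_or, OfNat.ofNat_ne_zero, not_false_eq_true, true_and]
      exact ⟨⟨by assumption, by assumption⟩, by assumption, by assumption⟩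
    all_goals
      simp only [quadraticPairing, jacobianPair]
      ring
end

section
/- Let F be a binary quartic form with complex coefficients, non-zero discriminant, non-zero x⁴-coefficient, and I(F)·J(F) ≠ 0. Then the four matrices I (the 2×2 identity), 𝒰₁, 𝒰₂, 𝒰₃ form a complete set of representatives in GL₂(ℂ) of the group Aut*_ℂ F ⊂ PGL₂(ℂ); moreover F_{𝒰ᵢ} = F for each i = 1,2,3. -/
/-- The matrix `𝒰 = (1/√(b² − 4ac)) M_f` attached to a binary quadratic form
`f = ax² + bxy + cy²` (principal square root). -/
noncomputable def Umat (a b c : ℂ) : Matrix (Fin 2) (Fin 2) ℂ :=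
  (csqrt (b ^ 2 - 4 * a * c))⁻¹ • Mmat a b c

/-- `𝒰₁`, built from the first Cremona covariant `𝔠₁` of the quartic with leading
coefficient `a₄` and roots `θ₁, θ₂, θ₃, θ₄`. -/
noncomputable def U1 (a₄ θ₁ θ₂ θ₃ θ₄ : ℂ) : Matrix (Fin 2) (Fin 2) ℂ :=
  Umat (a₄ * (θ₁ + θ₂ - θ₃ - θ₄)) (2 * a₄ * (θ₃ * θ₄ - θ₁ * θ₂))
    (a₄ * (θ₁ * θ₂ * (θ₃ + θ₄) - θ₃ * θ₄ * (θ₁ + θ₂)))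

/-- `𝒰₂`, built from the second Cremona covariant `𝔠₂`. -/
noncomputable def U2 (a₄ θ₁ θ₂ θ₃ θ₄ : ℂ) : Matrix (Fin 2) (Fin 2) ℂ :=
  Umat (a₄ * (θ₁ + θ₃ - θ₂ - θ₄)) (2 * a₄ * (θ₂ * θ₄ - θ₁ * θ₃))
    (a₄ * (θ₁ * θ₃ * (θ₂ + θ₄) - θ₂ * θ₄ * (θ₁ + θ₃)))

/-- `𝒰₃`, built from the third Cremona covariant `𝔠₃`. -/
noncomputable def U3 (a₄ θ₁ θ₂ θ₃ θ₄ : ℂ) : Matrix (Fin 2) (Fin 2) ℂ :=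
  Umat (a₄ * (θ₁ + θ₄ - θ₂ - θ₃)) (2 * a₄ * (θ₂ * θ₃ - θ₁ * θ₄))
    (a₄ * (θ₁ * θ₄ * (θ₂ + θ₃) - θ₂ * θ₃ * (θ₁ + θ₄)))

theorem csqrt_ne_zero {z : ℂ} (hz : z ≠ 0) : csqrt z ≠ 0 := by
  intro h
  exact hz (by rw [← csqrt_sq z, h]; simp)

theorem Mmat_mul_self (a b c : ℂ) : Mmat a b c * Mmat a b c = (b ^ 2 - 4 * a * c) • 1 := by
  ext i j
  fin_cases i <;> fin_cases j <;> simp [Mmat, Matrix.mul_apply] <;> ring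

theorem Umat_mul_self {a b c : ℂ} (hD : b ^ 2 - 4 * a * c ≠ 0) :
    Umat a b c * Umat a b c = 1 := by
  have h := csqrt_ne_zero hD
  rw [Umat, Matrix.smul_mul, Matrix.mul_smul, Mmat_mul_self, smul_smul, smul_smul,
    ← sq, inv_pow, csqrt_sq, inv_mul_cancel₀ hD, one_smul]

theorem Umat_det_ne_zero {a b c : ℂ} (hD : b ^ 2 - 4 * a * c ≠ 0) : (Umat a b c).det ≠ 0 := by
  intro h
  have := congrArg Matrix.det (Umat_mul_self hD)
  simp [h] at this

theorem one_ne_smul_Umat (a b c k : ℂ) : (1 : Matrix (Fin 2) (Fin 2) ℂ) ≠ k • Umat a b c := by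
  intro h
  have := congrArg Matrix.trace h
  simp [Umat, Mmat, Matrix.trace_fin_two] at this

/-- Matrices attached to apolar quadratic forms are not proportional. -/
theorem Umat_ne_smul_Umat {a b c a' b' c' : ℂ} (hD : b ^ 2 - 4 * a * c ≠ 0)
    (h : b * b' - 2 * a * c' - 2 * a' * c = 0) (k : ℂ) : Umat a b c ≠ k • Umat a' b' c' := by
  intro hk
  have h₁ := congrArg Matrix.trace (Umat_mul_self hD)
  have h₂ : (Umat a b c * Umat a' b' c').trace = 0 := by
    have : (Mmat a b c * Mmat a' b' c').trace = 0 := by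
      simp only [Mmat, Matrix.trace_fin_two, Matrix.mul_apply, Fin.sum_univ_two, Matrix.of_apply,
        Matrix.cons_val', Matrix.cons_val_zero, Matrix.cons_val_one, Matrix.cons_val_fin_one]
      linear_combination 2 * h
    simp [Umat, this]
  nth_rewrite 2 [hk] at h₁
  simp [h₂] at h₁

/-- The coefficients of a quartic with four distinct roots. -/
theorem quartic_vieta {a₄ a₃ a₂ a₁ a₀ θ₁ θ₂ θ₃ θ₄ : ℂ}
    (h₁ : quarticForm a₄ a₃ a₂ a₁ a₀ θ₁ 1 = 0)
    (h₂ : quarticForm a₄ a₃ a₂ a₁ a₀ θ₂ 1 = 0)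
    (h₃ : quarticForm a₄ a₃ a₂ a₁ a₀ θ₃ 1 = 0)
    (h₄ : quarticForm a₄ a₃ a₂ a₁ a₀ θ₄ 1 = 0)
    (hd : θ₁ ≠ θ₂ ∧ θ₁ ≠ θ₃ ∧ θ₁ ≠ θ₄ ∧ θ₂ ≠ θ₃ ∧ θ₂ ≠ θ₄ ∧ θ₃ ≠ θ₄) (x y : ℂ) :
    quarticForm a₄ a₃ a₂ a₁ a₀ x y =
      a₄ * ((x - θ₁ * y) * (x - θ₂ * y) * (x - θ₃ * y) * (x - θ₄ * y)) := by
  obtain ⟨h12, h13, h14, h23, h24, h34⟩ := hd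
  simp only [quarticForm] at *
  have q (s : ℂ) (hs : θ₁ - s ≠ 0)
      (h : a₄ * s ^ 4 + a₃ * s ^ 3 * 1 + a₂ * s ^ 2 * 1 ^ 2 + a₁ * s * 1 ^ 3 + a₀ * 1 ^ 4 = 0) :
      a₄ * (θ₁ ^ 3 + θ₁ ^ 2 * s + θ₁ * s ^ 2 + s ^ 3) + a₃ * (θ₁ ^ 2 + θ₁ * s + s ^ 2)
        + a₂ * (θ₁ + s) + a₁ = 0 := by
    apply mul_left_cancel₀ hs
    linear_combination h₁ - h
  have q2 := q θ₂ (sub_ne_zero.2 h12) h₂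
  have q3 := q θ₃ (sub_ne_zero.2 h13) h₃
  have q4 := q θ₄ (sub_ne_zero.2 h14) h₄
  have r3 : a₄ * (θ₁ ^ 2 + θ₁ * (θ₂ + θ₃) + θ₂ ^ 2 + θ₂ * θ₃ + θ₃ ^ 2)
      + a₃ * (θ₁ + θ₂ + θ₃) + a₂ = 0 := by
    apply mul_left_cancel₀ (sub_ne_zero.2 h23)
    linear_combination q2 - q3
  have r4 : a₄ * (θ₁ ^ 2 + θ₁ * (θ₂ + θ₄) + θ₂ ^ 2 + θ₂ * θ₄ + θ₄ ^ 2)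
      + a₃ * (θ₁ + θ₂ + θ₄) + a₂ = 0 := by
    apply mul_left_cancel₀ (sub_ne_zero.2 h24)
    linear_combination q2 - q4
  have s : a₄ * (θ₁ + θ₂ + θ₃ + θ₄) + a₃ = 0 := by
    apply mul_left_cancel₀ (sub_ne_zero.2 h34)
    linear_combination r3 - r4
  obtain rfl : a₃ = -(a₄ * (θ₁ + θ₂ + θ₃ + θ₄)) := by linear_combination s
  obtain rfl : a₂ = a₄ * (θ₁ * θ₂ + θ₁ * θ₃ + θ₁ * θ₄ + θ₂ * θ₃ + θ₂ * θ₄ + θ₃ * θ₄) := by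
    linear_combination r3
  obtain rfl : a₁ = -(a₄ * (θ₁ * θ₂ * θ₃ + θ₁ * θ₂ * θ₄ + θ₁ * θ₃ * θ₄ + θ₂ * θ₃ * θ₄)) := by
    linear_combination q2
  obtain rfl : a₀ = a₄ * (θ₁ * θ₂ * θ₃ * θ₄) := by
    linear_combination h₁
  ring

theorem cremona_disc_ne_zero {a θ₁ θ₂ θ₃ θ₄ : ℂ} (ha : a ≠ 0) (h13 : θ₁ ≠ θ₃) (h14 : θ₁ ≠ θ₄)
    (h23 : θ₂ ≠ θ₃) (h24 : θ₂ ≠ θ₄) :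
    (2 * a * (θ₃ * θ₄ - θ₁ * θ₂)) ^ 2 - 4 * (a * (θ₁ + θ₂ - θ₃ - θ₄)) *
      (a * (θ₁ * θ₂ * (θ₃ + θ₄) - θ₃ * θ₄ * (θ₁ + θ₂))) ≠ 0 := by
  have : 4 * a ^ 2 * ((θ₁ - θ₃) * (θ₁ - θ₄) * (θ₂ - θ₃) * (θ₂ - θ₄)) ≠ 0 := by
    simp [sub_ne_zero, *]
  convert this using 1
  ring

/-- `𝒰₁` leaves the quartic with leading coefficient `a` and roots `θᵢ` invariant. -/
theorem U1_invariant {a θ₁ θ₂ θ₃ θ₄ : ℂ} (ha : a ≠ 0) (h13 : θ₁ ≠ θ₃) (h14 : θ₁ ≠ θ₄)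
    (h23 : θ₂ ≠ θ₃) (h24 : θ₂ ≠ θ₄) {G : ℂ → ℂ → ℂ}
    (hG : ∀ x y, G x y = a * ((x - θ₁ * y) * (x - θ₂ * y) * (x - θ₃ * y) * (x - θ₄ * y)))
    (x y : ℂ) :
    G (U1 a θ₁ θ₂ θ₃ θ₄ 0 0 * x + U1 a θ₁ θ₂ θ₃ θ₄ 0 1 * y)
      (U1 a θ₁ θ₂ θ₃ θ₄ 1 0 * x + U1 a θ₁ θ₂ θ₃ θ₄ 1 1 * y) = G x y := by
  have hD := cremona_disc_ne_zero ha h13 h14 h23 h24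
  simp only [hG, U1, Umat, Mmat, Matrix.smul_apply, Matrix.of_apply, Matrix.cons_val',
    Matrix.cons_val_zero, Matrix.cons_val_one, Matrix.cons_val_fin_one, smul_eq_mul]
  have hs := csqrt_sq ((2 * a * (θ₃ * θ₄ - θ₁ * θ₂)) ^ 2 - 4 * (a * (θ₁ + θ₂ - θ₃ - θ₄)) *
      (a * (θ₁ * θ₂ * (θ₃ + θ₄) - θ₃ * θ₄ * (θ₁ + θ₂))))
  have hs0 := csqrt_ne_zero hD
  generalize csqrt _ = s at hs hs0 ⊢
  have hs' : s ^ 2 = 4 * a ^ 2 * ((θ₁ - θ₃) * (θ₁ - θ₄) * (θ₂ - θ₃) * (θ₂ - θ₄)) := by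
    rw [hs]; ring
  have hk : s⁻¹ ^ 4 * (4 * a ^ 2 * ((θ₁ - θ₃) * (θ₁ - θ₄) * (θ₂ - θ₃) * (θ₂ - θ₄))) ^ 2 = 1 := by
    rw [← hs']
    field_simp
  linear_combination
    a * ((x - θ₁ * y) * (x - θ₂ * y) * (x - θ₃ * y) * (x - θ₄ * y)) * hk

theorem U1_apply_root (a θ₁ θ₂ θ₃ θ₄ : ℂ) :
    U1 a θ₁ θ₂ θ₃ θ₄ 0 0 * θ₁ + U1 a θ₁ θ₂ θ₃ θ₄ 0 1 =
      θ₂ * (U1 a θ₁ θ₂ θ₃ θ₄ 1 0 * θ₁ + U1 a θ₁ θ₂ θ₃ θ₄ 1 1) := by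
  simp only [U1, Umat, Mmat, Matrix.smul_apply, Matrix.of_apply, Matrix.cons_val',
    Matrix.cons_val_zero, Matrix.cons_val_one, Matrix.cons_val_fin_one, smul_eq_mul]
  ring

/-- If a substitution `u ↦ αu`, `y ↦ βu + δy` preserves a quartic divisible by `u` up to
scaling, and the invariants of the quartic do not vanish, then it is scalar. -/
theorem triangular_automorphism_scalar {a b c d α β δ l : ℂ} (hΔ : quarticDisc a b c d 0 ≠ 0)
    (hI : quarticI a b c d 0 ≠ 0) (hJ : quarticJ a b c d 0 ≠ 0) (hα : α ≠ 0) (hδ : δ ≠ 0)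
    (h : ∀ u y : ℂ, quarticForm a b c d 0 (α * u) (β * u + δ * y) =
      l * quarticForm a b c d 0 u y) : α = δ ∧ β = 0 := by
  simp only [quarticDisc, quarticI, quarticJ, quarticForm] at *
  have hd : d ≠ 0 := by
    rintro rfl
    apply hΔ
    ring
  have e0 := h 1 0
  have e1 := h 1 1
  have e2 := h 1 (-1)
  have e3 := h 1 2
  have c1 : l = α * δ ^ 3 := by
    apply mul_left_cancel₀ hd
    linear_combination (-1/2) * e0 + (1/2) * e1 + (1/6) * e2 - (1/6) * e3
  subst c1
  have c2 : 3 * d * β + c * α = c * δ := by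
    apply mul_left_cancel₀ (mul_ne_zero hα (pow_ne_zero 2 hδ))
    linear_combination -e0 + (1/2) * e1 + (1/2) * e2
  have c3 : 3 * d * β ^ 2 + 2 * c * α * β + b * α ^ 2 = b * δ ^ 2 := by
    apply mul_left_cancel₀ (mul_ne_zero hα hδ)
    linear_combination (-1/2) * e0 + e1 - (1/3) * e2 - (1/6) * e3
  have c4 : d * β ^ 3 + c * α * β ^ 2 + b * α ^ 2 * β + a * α ^ 3 = a * δ ^ 3 := by
    apply mul_left_cancel₀ hα
    linear_combination e0
  have hβ : β = c * (δ - α) / (3 * d) := by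
    field_simp
    linear_combination c2
  have s2 : δ ^ 2 = α ^ 2 := by
    apply mul_left_cancel₀ hI
    subst hβ
    field_simp at c3
    linear_combination c3
  have s3 : δ ^ 3 = α ^ 3 := by
    apply mul_left_cancel₀ hJ
    subst hβ
    field_simp at c4
    linear_combination c4 + (9 * b * c * d - 3 * c ^ 3) * δ * s2
  have hαδ : α = δ := by
    apply mul_left_cancel₀ (pow_ne_zero 2 hα)
    linear_combination -s3 + δ * s2
  refine ⟨hαδ, ?_⟩
  rw [hβ, hαδ]
  simp

/-- An automorphism up to scaling fixing a root of the quartic is scalar. -/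
theorem automorphism_fixing_root_scalar {a₄ a₃ a₂ a₁ a₀ θ l : ℂ}
    (hΔ : quarticDisc a₄ a₃ a₂ a₁ a₀ ≠ 0) (hI : quarticI a₄ a₃ a₂ a₁ a₀ ≠ 0)
    (hJ : quarticJ a₄ a₃ a₂ a₁ a₀ ≠ 0) (hθ : quarticForm a₄ a₃ a₂ a₁ a₀ θ 1 = 0)
    {S : Matrix (Fin 2) (Fin 2) ℂ} (hS : S.det ≠ 0)
    (hfix : S 0 0 * θ + S 0 1 = θ * (S 1 0 * θ + S 1 1))
    (h : ∀ x y : ℂ,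
      quarticForm a₄ a₃ a₂ a₁ a₀ (S 0 0 * x + S 0 1 * y) (S 1 0 * x + S 1 1 * y)
        = l * quarticForm a₄ a₃ a₂ a₁ a₀ x y) : ∃ c : ℂ, S = c • 1 := by
  have hθ' := hθ
  simp only [quarticForm] at hθ'
  obtain rfl : a₀ = -(a₄ * θ ^ 4 + a₃ * θ ^ 3 + a₂ * θ ^ 2 + a₁ * θ) := by
    linear_combination hθ'
  set b := 4 * a₄ * θ + a₃ with hb
  set c := 6 * a₄ * θ ^ 2 + 3 * a₃ * θ + a₂ with hc
  set d := 4 * a₄ * θ ^ 3 + 3 * a₃ * θ ^ 2 + 2 * a₂ * θ + a₁ with hd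
  have eI : quarticI a₄ b c d 0 =
      quarticI a₄ a₃ a₂ a₁ (-(a₄ * θ ^ 4 + a₃ * θ ^ 3 + a₂ * θ ^ 2 + a₁ * θ)) := by
    simp only [quarticI, hb, hc, hd]; ring
  have eJ : quarticJ a₄ b c d 0 =
      quarticJ a₄ a₃ a₂ a₁ (-(a₄ * θ ^ 4 + a₃ * θ ^ 3 + a₂ * θ ^ 2 + a₁ * θ)) := by
    simp only [quarticJ, hb, hc, hd]; ring
  have eF (u y : ℂ) : quarticForm a₄ b c d 0 u y =
      quarticForm a₄ a₃ a₂ a₁ (-(a₄ * θ ^ 4 + a₃ * θ ^ 3 + a₂ * θ ^ 2 + a₁ * θ))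
        (u + θ * y) y := by
    simp only [quarticForm, hb, hc, hd]; ring
  have hdet : (S 0 0 - θ * S 1 0) * (S 1 0 * θ + S 1 1) ≠ 0 := by
    convert hS using 1
    rw [Matrix.det_fin_two]
    linear_combination S 1 0 * hfix
  obtain ⟨hα, hδ⟩ := mul_ne_zero_iff.1 hdet
  obtain ⟨h1, h2⟩ := triangular_automorphism_scalar (a := a₄) (b := b) (c := c) (d := d)
    (β := S 1 0) (l := l) (by rwa [quarticDisc, eI, eJ]) (by rwa [eI]) (by rwa [eJ]) hα hδ
    (by
      intro u y
      rw [eF, eF, ← h]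
      congr 1
      · linear_combination (-y) * hfix
      · ring)
  rw [h2] at h1 hfix
  refine ⟨S 0 0, ?_⟩
  have h01 : S 0 1 = 0 := by linear_combination hfix - θ * h1
  have h11 : S 1 1 = S 0 0 := by linear_combination -h1
  ext i j
  fin_cases i <;> fin_cases j <;> simp [h2, h01, h11]

/-- An automorphism up to scaling sending the second root to the first one is a multiple
of `𝒰₁`. -/
theorem automorphism_eq_smul_U1 {a₄ a₃ a₂ a₁ a₀ θ₁ θ₂ θ₃ θ₄ l : ℂ} (ha : a₄ ≠ 0)
    (h13 : θ₁ ≠ θ₃) (h14 : θ₁ ≠ θ₄) (h23 : θ₂ ≠ θ₃) (h24 : θ₂ ≠ θ₄)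
    (hΔ : quarticDisc a₄ a₃ a₂ a₁ a₀ ≠ 0) (hI : quarticI a₄ a₃ a₂ a₁ a₀ ≠ 0)
    (hJ : quarticJ a₄ a₃ a₂ a₁ a₀ ≠ 0) (hθ : quarticForm a₄ a₃ a₂ a₁ a₀ θ₁ 1 = 0)
    (hG : ∀ x y, quarticForm a₄ a₃ a₂ a₁ a₀ x y =
      a₄ * ((x - θ₁ * y) * (x - θ₂ * y) * (x - θ₃ * y) * (x - θ₄ * y)))
    {T : Matrix (Fin 2) (Fin 2) ℂ} (hT : T.det ≠ 0)
    (hroot : T 0 0 * θ₂ + T 0 1 = θ₁ * (T 1 0 * θ₂ + T 1 1))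
    (h : ∀ x y : ℂ,
      quarticForm a₄ a₃ a₂ a₁ a₀ (T 0 0 * x + T 0 1 * y) (T 1 0 * x + T 1 1 * y)
        = l * quarticForm a₄ a₃ a₂ a₁ a₀ x y) : ∃ c : ℂ, T = c • U1 a₄ θ₁ θ₂ θ₃ θ₄ := by
  have hD := cremona_disc_ne_zero ha h13 h14 h23 h24
  have hU := U1_invariant ha h13 h14 h23 h24 hG
  have hr := U1_apply_root a₄ θ₁ θ₂ θ₃ θ₄
  have hsq : U1 a₄ θ₁ θ₂ θ₃ θ₄ * U1 a₄ θ₁ θ₂ θ₃ θ₄ = 1 := Umat_mul_self hD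
  have hdet : (U1 a₄ θ₁ θ₂ θ₃ θ₄).det ≠ 0 := Umat_det_ne_zero hD
  generalize U1 a₄ θ₁ θ₂ θ₃ θ₄ = U at *
  obtain ⟨c, hc⟩ := automorphism_fixing_root_scalar (S := T * U) (l := l) hΔ hI hJ hθ
    (by rw [Matrix.det_mul]; exact mul_ne_zero hT hdet)
    (by
      simp only [Matrix.mul_apply, Fin.sum_univ_two]
      linear_combination (T 0 0 - θ₁ * T 1 0) * hr + (U 1 0 * θ₁ + U 1 1) * hroot)
    (by
      intro x y
      rw [← hU x y, ← h]
      simp only [Matrix.mul_apply, Fin.sum_univ_two]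
      congr 1 <;> ring)
  refine ⟨c, ?_⟩
  rw [← mul_one T, ← hsq, ← mul_assoc, hc, Matrix.smul_mul, one_mul]

/-- For a binary quartic form `F` with complex coefficients, non-zero discriminant, non-zero
`x⁴`-coefficient and `I(F)·J(F) ≠ 0`, with roots `θ₁, …, θ₄` of `F(x,1)`, the four matrices
`I, 𝒰₁, 𝒰₂, 𝒰₃` form a complete set of representatives in `GL₂(ℂ)` of
`Aut*_ℂ F ⊆ PGL₂(ℂ)`; moreover `F_{𝒰ᵢ} = F` for each `i`. -/
theorem quartic_projective_automorphism_reps (a₄ a₃ a₂ a₁ a₀ θ₁ θ₂ θ₃ θ₄ : ℂ)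
    (ha₄ : a₄ ≠ 0) (hΔ : quarticDisc a₄ a₃ a₂ a₁ a₀ ≠ 0)
    (hIJ : quarticI a₄ a₃ a₂ a₁ a₀ * quarticJ a₄ a₃ a₂ a₁ a₀ ≠ 0)
    (h₁ : quarticForm a₄ a₃ a₂ a₁ a₀ θ₁ 1 = 0)
    (h₂ : quarticForm a₄ a₃ a₂ a₁ a₀ θ₂ 1 = 0)
    (h₃ : quarticForm a₄ a₃ a₂ a₁ a₀ θ₃ 1 = 0)
    (h₄ : quarticForm a₄ a₃ a₂ a₁ a₀ θ₄ 1 = 0)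
    (hd : θ₁ ≠ θ₂ ∧ θ₁ ≠ θ₃ ∧ θ₁ ≠ θ₄ ∧ θ₂ ≠ θ₃ ∧ θ₂ ≠ θ₄ ∧ θ₃ ≠ θ₄) :
    (∀ M ∈ [(1 : Matrix (Fin 2) (Fin 2) ℂ), U1 a₄ θ₁ θ₂ θ₃ θ₄, U2 a₄ θ₁ θ₂ θ₃ θ₄,
        U3 a₄ θ₁ θ₂ θ₃ θ₄],
      M.det ≠ 0 ∧ ∀ x y : ℂ,
        quarticForm a₄ a₃ a₂ a₁ a₀ (M 0 0 * x + M 0 1 * y) (M 1 0 * x + M 1 1 * y)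
          = quarticForm a₄ a₃ a₂ a₁ a₀ x y) ∧
    List.Pairwise (fun M M' : Matrix (Fin 2) (Fin 2) ℂ => ∀ c : ℂ, M ≠ c • M')
      [(1 : Matrix (Fin 2) (Fin 2) ℂ), U1 a₄ θ₁ θ₂ θ₃ θ₄, U2 a₄ θ₁ θ₂ θ₃ θ₄,
        U3 a₄ θ₁ θ₂ θ₃ θ₄] ∧
    (∀ T : Matrix (Fin 2) (Fin 2) ℂ, T.det ≠ 0 →
      (∃ l : ℂ, l ≠ 0 ∧ ∀ x y : ℂ,
        quarticForm a₄ a₃ a₂ a₁ a₀ (T 0 0 * x + T 0 1 * y) (T 1 0 * x + T 1 1 * y)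
          = l * quarticForm a₄ a₃ a₂ a₁ a₀ x y) →
      ∃ M ∈ [(1 : Matrix (Fin 2) (Fin 2) ℂ), U1 a₄ θ₁ θ₂ θ₃ θ₄, U2 a₄ θ₁ θ₂ θ₃ θ₄,
        U3 a₄ θ₁ θ₂ θ₃ θ₄], ∃ c : ℂ, T = c • M) := by
  have hF := quartic_vieta h₁ h₂ h₃ h₄ hd
  obtain ⟨h12, h13, h14, h23, h24, h34⟩ := hd
  obtain ⟨hI, hJ⟩ := mul_ne_zero_iff.1 hIJ
  have hF₂ : ∀ x y, quarticForm a₄ a₃ a₂ a₁ a₀ x y =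
      a₄ * ((x - θ₁ * y) * (x - θ₃ * y) * (x - θ₂ * y) * (x - θ₄ * y)) := by
    intro x y; rw [hF]; ring
  have hF₃ : ∀ x y, quarticForm a₄ a₃ a₂ a₁ a₀ x y =
      a₄ * ((x - θ₁ * y) * (x - θ₄ * y) * (x - θ₂ * y) * (x - θ₃ * y)) := by
    intro x y; rw [hF]; ring
  have hD₁ := cremona_disc_ne_zero ha₄ h13 h14 h23 h24
  have hD₂ := cremona_disc_ne_zero ha₄ h12 h14 h23.symm h34
  have hD₃ := cremona_disc_ne_zero ha₄ h12 h13 h24.symm h34.symm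
  refine ⟨?_, ?_, ?_⟩
  · intro M hM
    simp only [List.mem_cons, List.not_mem_nil, or_false] at hM
    rcases hM with rfl | rfl | rfl | rfl
    · simp
    · exact ⟨Umat_det_ne_zero hD₁, U1_invariant ha₄ h13 h14 h23 h24 hF⟩
    · exact ⟨Umat_det_ne_zero hD₂, U1_invariant ha₄ h12 h14 h23.symm h34 hF₂⟩
    · exact ⟨Umat_det_ne_zero hD₃, U1_invariant ha₄ h12 h13 h24.symm h34.symm hF₃⟩
  · simp only [List.pairwise_cons, List.mem_cons, List.not_mem_nil, or_false, forall_eq_or_imp,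
      forall_eq, IsEmpty.forall_iff, implies_true, List.Pairwise.nil, and_true]
    refine ⟨⟨one_ne_smul_Umat _ _ _, one_ne_smul_Umat _ _ _, one_ne_smul_Umat _ _ _⟩,
      ⟨Umat_ne_smul_Umat hD₁ ?_, Umat_ne_smul_Umat hD₁ ?_⟩, Umat_ne_smul_Umat hD₂ ?_⟩ <;> ring
  · rintro T hT ⟨l, hl, h⟩
    set w₀ := T 1 1 * θ₁ - T 0 1 with hw₀
    set w₁ := T 0 0 - T 1 0 * θ₁ with hw₁
    have hw : quarticForm a₄ a₃ a₂ a₁ a₀ w₀ w₁ = 0 := by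
      apply mul_left_cancel₀ hl
      rw [← h, hF, hw₀, hw₁]
      ring
    have key (θ : ℂ) (hθ : w₀ - θ * w₁ = 0) :
        T 0 0 * θ + T 0 1 = θ₁ * (T 1 0 * θ + T 1 1) := by
      linear_combination -hθ
    rw [hF] at hw
    simp only [mul_eq_zero, ha₄, false_or] at hw
    rcases hw with ((hw | hw) | hw) | hw
    · obtain ⟨c, hc⟩ := automorphism_fixing_root_scalar hΔ hI hJ h₁ hT (key _ hw) h
      exact ⟨1, by simp, c, hc⟩
    · obtain ⟨c, hc⟩ := automorphism_eq_smul_U1 ha₄ h13 h14 h23 h24 hΔ hI hJ h₁ hF hT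
        (key _ hw) h
      exact ⟨_, by simp, c, hc⟩
    · obtain ⟨c, hc⟩ := automorphism_eq_smul_U1 ha₄ h12 h14 h23.symm h34 hΔ hI hJ h₁ hF₂ hT
        (key _ hw) h
      exact ⟨U2 a₄ θ₁ θ₂ θ₃ θ₄, by simp, c, hc⟩
    · obtain ⟨c, hc⟩ := automorphism_eq_smul_U1 ha₄ h12 h13 h24.symm h34.symm hΔ hI hJ h₁ hF₃ hT
        (key _ hw) h
      exact ⟨U3 a₄ θ₁ θ₂ θ₃ θ₄, by simp, c, hc⟩
end

section
/- Let F be a binary quartic form with complex coefficients, non-zero discriminant, and non-zero x⁴-coefficient. Then for each i = 1, 2, 3 the Cremona covariant 𝔠ᵢ is a significant quadratic factor of the sextic covariant F₆; that is, 𝔠ᵢ divides F₆ and the quartic form F₆/𝔠ᵢ satisfies J(F₆/𝔠ᵢ) = 0. -/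
/-- The sextic covariant `F₆` of a binary quartic form, as a function. -/
noncomputable def sexticCovForm (a₄ a₃ a₂ a₁ a₀ x y : ℂ) : ℂ :=
  (a₃ ^ 3 + 8 * a₄ ^ 2 * a₁ - 4 * a₄ * a₃ * a₂) * x ^ 6
    + 2 * (16 * a₄ ^ 2 * a₀ + 2 * a₄ * a₃ * a₁ - 4 * a₄ * a₂ ^ 2 + a₃ ^ 2 * a₂) * x ^ 5 * y
    + 5 * (8 * a₄ * a₃ * a₀ + a₃ ^ 2 * a₁ - 4 * a₄ * a₂ * a₁) * x ^ 4 * y ^ 2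
    + 20 * (a₃ ^ 2 * a₀ - a₄ * a₁ ^ 2) * x ^ 3 * y ^ 3
    - 5 * (8 * a₄ * a₁ * a₀ + a₃ * a₁ ^ 2 - 4 * a₃ * a₂ * a₀) * x ^ 2 * y ^ 4
    - 2 * (16 * a₄ * a₀ ^ 2 + 2 * a₃ * a₁ * a₀ - 4 * a₂ ^ 2 * a₀ + a₂ * a₁ ^ 2) * x * y ^ 5
    - (a₁ ^ 3 + 8 * a₃ * a₀ ^ 2 - 4 * a₂ * a₁ * a₀) * y ^ 6

/-- The quadratic form `Ax² + Bxy + Cy²` is a significant factor of the sextic covariant of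
the quartic form with coefficients `a₄, …, a₀`: it divides `F₆` and the quotient quartic has
vanishing invariant `J`. -/
def IsSigFactorOfSexticCov (a₄ a₃ a₂ a₁ a₀ A B C : ℂ) : Prop :=
  ∃ c₄ c₃ c₂ c₁ c₀ : ℂ,
    (∀ x y : ℂ, sexticCovForm a₄ a₃ a₂ a₁ a₀ x y =
      (A * x ^ 2 + B * x * y + C * y ^ 2) * quarticForm c₄ c₃ c₂ c₁ c₀ x y) ∧
    quarticJ c₄ c₃ c₂ c₁ c₀ = 0

/-- Vieta's formulas for a binary quartic form with four distinct roots. -/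
theorem quarticForm_vieta {a₄ a₃ a₂ a₁ a₀ θ₁ θ₂ θ₃ θ₄ : ℂ}
    (h₁ : quarticForm a₄ a₃ a₂ a₁ a₀ θ₁ 1 = 0)
    (h₂ : quarticForm a₄ a₃ a₂ a₁ a₀ θ₂ 1 = 0)
    (h₃ : quarticForm a₄ a₃ a₂ a₁ a₀ θ₃ 1 = 0)
    (h₄ : quarticForm a₄ a₃ a₂ a₁ a₀ θ₄ 1 = 0)
    (h₁₂ : θ₁ ≠ θ₂) (h₁₃ : θ₁ ≠ θ₃) (h₁₄ : θ₁ ≠ θ₄)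
    (h₂₃ : θ₂ ≠ θ₃) (h₂₄ : θ₂ ≠ θ₄) (h₃₄ : θ₃ ≠ θ₄) :
    a₃ = -a₄ * (θ₁ + θ₂ + θ₃ + θ₄) ∧
    a₂ = a₄ * (θ₁ * θ₂ + θ₁ * θ₃ + θ₁ * θ₄ + θ₂ * θ₃ + θ₂ * θ₄ + θ₃ * θ₄) ∧
    a₁ = -a₄ * (θ₁ * θ₂ * θ₃ + θ₁ * θ₂ * θ₄ + θ₁ * θ₃ * θ₄ + θ₂ * θ₃ * θ₄) ∧
    a₀ = a₄ * (θ₁ * θ₂ * θ₃ * θ₄) := by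
  unfold quarticForm at h₁ h₂ h₃ h₄
  have first (s t : ℂ) (hst : s ≠ t)
      (hs : a₄ * s ^ 4 + a₃ * s ^ 3 * 1 + a₂ * s ^ 2 * 1 ^ 2 + a₁ * s * 1 ^ 3 + a₀ * 1 ^ 4 = 0)
      (ht : a₄ * t ^ 4 + a₃ * t ^ 3 * 1 + a₂ * t ^ 2 * 1 ^ 2 + a₁ * t * 1 ^ 3 + a₀ * 1 ^ 4 = 0) :
      a₄ * (s ^ 3 + s ^ 2 * t + s * t ^ 2 + t ^ 3) + a₃ * (s ^ 2 + s * t + t ^ 2)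
        + a₂ * (s + t) + a₁ = 0 := by
    apply mul_left_cancel₀ (sub_ne_zero.mpr hst)
    linear_combination hs - ht
  have d₂ := first θ₁ θ₂ h₁₂ h₁ h₂
  have d₃ := first θ₁ θ₃ h₁₃ h₁ h₃
  have d₄ := first θ₁ θ₄ h₁₄ h₁ h₄
  have second (s t : ℂ) (hst : s ≠ t)
      (hs : a₄ * (θ₁ ^ 3 + θ₁ ^ 2 * s + θ₁ * s ^ 2 + s ^ 3) + a₃ * (θ₁ ^ 2 + θ₁ * s + s ^ 2)
        + a₂ * (θ₁ + s) + a₁ = 0)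
      (ht : a₄ * (θ₁ ^ 3 + θ₁ ^ 2 * t + θ₁ * t ^ 2 + t ^ 3) + a₃ * (θ₁ ^ 2 + θ₁ * t + t ^ 2)
        + a₂ * (θ₁ + t) + a₁ = 0) :
      a₄ * (θ₁ ^ 2 + s ^ 2 + t ^ 2 + θ₁ * s + θ₁ * t + s * t) + a₃ * (θ₁ + s + t) + a₂ = 0 := by
    apply mul_left_cancel₀ (sub_ne_zero.mpr hst)
    linear_combination hs - ht
  have e₃ := second θ₂ θ₃ h₂₃ d₂ d₃
  have e₄ := second θ₂ θ₄ h₂₄ d₂ d₄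
  have v₃ : a₃ = -a₄ * (θ₁ + θ₂ + θ₃ + θ₄) := by
    apply mul_left_cancel₀ (sub_ne_zero.mpr h₃₄)
    linear_combination e₃ - e₄
  have v₂ : a₂ = a₄ * (θ₁ * θ₂ + θ₁ * θ₃ + θ₁ * θ₄ + θ₂ * θ₃ + θ₂ * θ₄ + θ₃ * θ₄) := by
    linear_combination e₃ - (θ₁ + θ₂ + θ₃) * v₃
  have v₁ : a₁ = -a₄ * (θ₁ * θ₂ * θ₃ + θ₁ * θ₂ * θ₄ + θ₁ * θ₃ * θ₄ + θ₂ * θ₃ * θ₄) := by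
    linear_combination d₂ - (θ₁ + θ₂) * v₂ - (θ₁ ^ 2 + θ₁ * θ₂ + θ₂ ^ 2) * v₃
  refine ⟨v₃, v₂, v₁, ?_⟩
  linear_combination h₁ - θ₁ * v₁ - θ₁ ^ 2 * v₂ - θ₁ ^ 3 * v₃

/-- The invariant `J` of a product of two apolar quadratic forms vanishes. -/
theorem quarticJ_mul_of_apolar {A B C A' B' C' : ℂ}
    (h : 2 * A * C' + 2 * C * A' = B * B') :
    quarticJ (-(A * A')) (-(A * B' + B * A')) (-(A * C' + B * B' + C * A'))
      (-(B * C' + C * B')) (-(C * C')) = 0 := by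
  unfold quarticJ
  linear_combination ((2 * A * C' + 2 * C * A' - B * B') ^ 2
    - 9 * (B ^ 2 - 4 * A * C) * (B' ^ 2 - 4 * A' * C')) / 4 * h

/-- If the coefficients are given by Vieta's formulas, the first Cremona covariant is a
significant factor; the quotient is minus the product of the other two. -/
theorem isSigFactorOfSexticCov_of_vieta {a₄ a₃ a₂ a₁ a₀ θ₁ θ₂ θ₃ θ₄ : ℂ}
    (h : a₃ = -a₄ * (θ₁ + θ₂ + θ₃ + θ₄) ∧
      a₂ = a₄ * (θ₁ * θ₂ + θ₁ * θ₃ + θ₁ * θ₄ + θ₂ * θ₃ + θ₂ * θ₄ + θ₃ * θ₄) ∧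
      a₁ = -a₄ * (θ₁ * θ₂ * θ₃ + θ₁ * θ₂ * θ₄ + θ₁ * θ₃ * θ₄ + θ₂ * θ₃ * θ₄) ∧
      a₀ = a₄ * (θ₁ * θ₂ * θ₃ * θ₄)) :
    IsSigFactorOfSexticCov a₄ a₃ a₂ a₁ a₀
      (a₄ * (θ₁ + θ₂ - θ₃ - θ₄)) (2 * a₄ * (θ₃ * θ₄ - θ₁ * θ₂))
      (a₄ * (θ₁ * θ₂ * (θ₃ + θ₄) - θ₃ * θ₄ * (θ₁ + θ₂))) := by
  obtain ⟨rfl, rfl, rfl, rfl⟩ := h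
  refine ⟨_, _, _, _, _, fun x y => ?_, quarticJ_mul_of_apolar
    (A := a₄ * (θ₁ + θ₃ - θ₂ - θ₄)) (B := 2 * a₄ * (θ₂ * θ₄ - θ₁ * θ₃))
    (C := a₄ * (θ₁ * θ₃ * (θ₂ + θ₄) - θ₂ * θ₄ * (θ₁ + θ₃)))
    (A' := a₄ * (θ₁ + θ₄ - θ₂ - θ₃)) (B' := 2 * a₄ * (θ₂ * θ₃ - θ₁ * θ₄))
    (C' := a₄ * (θ₁ * θ₄ * (θ₂ + θ₃) - θ₂ * θ₃ * (θ₁ + θ₄))) ?_⟩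
  · unfold sexticCovForm quarticForm
    ring
  · ring

/-- For a binary quartic form with non-zero discriminant and non-zero `x⁴`-coefficient, each
of the three Cremona covariants `𝔠ᵢ` is a significant quadratic factor of the sextic
covariant `F₆`. -/
theorem cremona_covariants_are_significant (a₄ a₃ a₂ a₁ a₀ : ℂ) (θ₁ θ₂ θ₃ θ₄ : ℂ)
    (ha₄ : a₄ ≠ 0) (hΔ : quarticDisc a₄ a₃ a₂ a₁ a₀ ≠ 0)
    (h₁ : quarticForm a₄ a₃ a₂ a₁ a₀ θ₁ 1 = 0)
    (h₂ : quarticForm a₄ a₃ a₂ a₁ a₀ θ₂ 1 = 0)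
    (h₃ : quarticForm a₄ a₃ a₂ a₁ a₀ θ₃ 1 = 0)
    (h₄ : quarticForm a₄ a₃ a₂ a₁ a₀ θ₄ 1 = 0)
    (hd : θ₁ ≠ θ₂ ∧ θ₁ ≠ θ₃ ∧ θ₁ ≠ θ₄ ∧ θ₂ ≠ θ₃ ∧ θ₂ ≠ θ₄ ∧ θ₃ ≠ θ₄) :
    IsSigFactorOfSexticCov a₄ a₃ a₂ a₁ a₀
        (a₄ * (θ₁ + θ₂ - θ₃ - θ₄)) (2 * a₄ * (θ₃ * θ₄ - θ₁ * θ₂))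
        (a₄ * (θ₁ * θ₂ * (θ₃ + θ₄) - θ₃ * θ₄ * (θ₁ + θ₂))) ∧
    IsSigFactorOfSexticCov a₄ a₃ a₂ a₁ a₀
        (a₄ * (θ₁ + θ₃ - θ₂ - θ₄)) (2 * a₄ * (θ₂ * θ₄ - θ₁ * θ₃))
        (a₄ * (θ₁ * θ₃ * (θ₂ + θ₄) - θ₂ * θ₄ * (θ₁ + θ₃))) ∧
    IsSigFactorOfSexticCov a₄ a₃ a₂ a₁ a₀
        (a₄ * (θ₁ + θ₄ - θ₂ - θ₃)) (2 * a₄ * (θ₂ * θ₃ - θ₁ * θ₄))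
        (a₄ * (θ₁ * θ₄ * (θ₂ + θ₃) - θ₂ * θ₃ * (θ₁ + θ₄))) := by
  obtain ⟨h₁₂, h₁₃, h₁₄, h₂₃, h₂₄, h₃₄⟩ := hd
  exact ⟨isSigFactorOfSexticCov_of_vieta
      (quarticForm_vieta h₁ h₂ h₃ h₄ h₁₂ h₁₃ h₁₄ h₂₃ h₂₄ h₃₄),
    isSigFactorOfSexticCov_of_vieta
      (quarticForm_vieta h₁ h₃ h₂ h₄ h₁₃ h₁₂ h₁₄ h₂₃.symm h₃₄ h₂₄),
    isSigFactorOfSexticCov_of_vieta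
      (quarticForm_vieta h₁ h₄ h₂ h₃ h₁₄ h₁₂ h₁₃ h₂₄.symm h₃₄.symm h₂₃)⟩
end
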